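/- There exists a subgroup K of the fundamental group π₁(𝓗, 0) of the Hawaiian Earring 𝓗 such that K is open (i.e., h⁻¹(K) is open in the loop space Ω(𝓗,0) with the compact-open topology) and K is core-free, i.e., the only normal subgroup of π₁(𝓗,0) contained in K is the trivial subgroup. -/

import Mathlib

/-- The homotopy class of a loop, as an element of the fundamental group. -/
noncomputable def pathClass {X : Type*} [TopologicalSpace X] {x : X} (γ : Path x x) :
    FundamentalGroup X x :=
  FundamentalGroup.fromPath (X := TopCat.of X) (Quotient.mk (Path.Homotopic.setoid x x) γ)

/-- The `i`-th circle of the Hawaiian Earring: the circle of radius `1/i`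
centered at `(0, 1/i)`. -/
def hawaiianCircle (i : ℕ) : Set (ℝ × ℝ) :=
  {p | p.1 ^ 2 + (p.2 - 1 / (i : ℝ)) ^ 2 = (1 / (i : ℝ)) ^ 2}

/-- The Hawaiian Earring `𝓗 = ⋃_{i ≥ 1} C_i ⊆ ℝ²`, with the subspace topology. -/
def HawaiianEarring : Set (ℝ × ℝ) :=
  ⋃ i ∈ {i : ℕ | 1 ≤ i}, hawaiianCircle i

/-- The basepoint `0 = (0,0)` of the Hawaiian Earring. -/
def hawaiianBasepoint : HawaiianEarring :=
  ⟨(0, 0), Set.mem_iUnion₂.mpr ⟨1, by simp, by simp [hawaiianCircle]⟩⟩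


open Set Filter Topology unitInterval

/-- A loop factoring through the real tree coded by `f` is null-homotopic. -/
theorem null_of_contour {X : Type*} [TopologicalSpace X] {x0 : X} (γ : Path x0 x0) (f : I → ℝ)
    (hf : Continuous f) (h0 : f 0 = 0) (h1 : f 1 = 0) (hn : ∀ s, 0 ≤ f s)
    (H : ∀ s t, s ≤ t → f s = f t → (∀ r, s ≤ r → r ≤ t → f s ≤ f r) → γ s = γ t) :
    γ.Homotopic (Path.refl x0) := by
  obtain ⟨M, hM⟩ : ∃ M : ℝ, ∀ s, f s ≤ M := by
    obtain ⟨M, hM⟩ := (isCompact_range hf).bddAbove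
    exact ⟨M, fun s => hM ⟨s, rfl⟩⟩
  have hM0 : 0 ≤ M := (hn 0).trans (hM 0)
  let R : I → ℝ → I → Prop := fun s h t => s ≤ t ∧ f t = min (f s) h ∧ ∀ r, s ≤ r → r ≤ t → f t ≤ f r
  have Rex : ∀ s h, 0 ≤ h → ∃ t, R s h t := by
    intro s h hh
    by_cases hs : f s ≤ h
    · exact ⟨s, le_rfl, by simp [hs], fun r h1 h2 => by rw [le_antisymm h2 h1]⟩
    · push Not at hs
      have hc : IsCompact {t : I | s ≤ t ∧ f t ≤ h} := by
        apply IsClosed.isCompact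
        exact (isClosed_Ici).inter (isClosed_le hf continuous_const)
      obtain ⟨t, ⟨hst, hth⟩, hleast⟩ := hc.exists_isLeast ⟨1, le_one', by simpa [h1] using hh⟩
      have key : ∀ r, s ≤ r → r < t → h < f r := by
        intro r hr hrt
        by_contra hcon
        exact absurd (hleast ⟨hr, not_lt.1 hcon⟩) (not_le.2 hrt)
      have hth' : f t = h := by
        have := intermediate_value_Icc' hst hf.continuousOn
        obtain ⟨c, hc, hch⟩ := this ⟨hth, hs.le⟩
        rcases hc.2.lt_or_eq with h' | h'
        · exact absurd (key c hc.1 h') (by simp [hch])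
        · rw [← h', hch]
      refine ⟨t, hst, by rw [hth', min_eq_right hs.le], fun r hr hrt => ?_⟩
      rcases hrt.lt_or_eq with h' | h'
      · rw [hth']; exact (key r hr h').le
      · rw [h']
  have Runi : ∀ s h t t', R s h t → R s h t' → γ t = γ t' := by
    intro s h
    have aux : ∀ t t', t ≤ t' → R s h t → R s h t' → γ t = γ t' := by
      intro t t' htt ht ht'
      refine H t t' htt (ht.2.1.trans ht'.2.1.symm) fun r hr hr' => ?_
      rw [ht.2.1.trans ht'.2.1.symm]
      exact ht'.2.2 r (ht.1.trans hr) hr'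
    intro t t' ht ht'
    rcases le_total t t' with h' | h'
    · exact aux t t' h' ht ht'
    · exact (aux t' t h' ht' ht).symm
  have hh : ∀ r : I, 0 ≤ (1 - (r : ℝ)) * M := fun r => mul_nonneg (by linarith [r.2.2]) hM0
  choose T hT using fun p : I × I => Rex p.2 ((1 - (p.1 : ℝ)) * M) (hh p.1)
  have hcont : Continuous fun p : I × I => γ (T p) := by
    rw [continuous_iff_ultrafilter]
    intro p g hg
    obtain ⟨t', -, ht'⟩ := isCompact_univ.ultrafilter_le_nhds (g.map T) (by simp)
    have ht' : Tendsto T g (𝓝 t') := ht'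
    have hp2 : Tendsto (fun q : I × I => q.2) g (𝓝 p.2) := (continuous_snd.tendsto p).mono_left hg
    have hR : R p.2 ((1 - (p.1 : ℝ)) * M) t' := by
      have e1 : f t' = min (f p.2) ((1 - (p.1 : ℝ)) * M) := by
        have a1 : Tendsto (fun q => f (T q)) g (𝓝 (f t')) := (hf.tendsto t').comp ht'
        have a2 : Tendsto (fun q : I × I => min (f q.2) ((1 - (q.1 : ℝ)) * M)) g
            (𝓝 (min (f p.2) ((1 - (p.1 : ℝ)) * M))) := by
          refine Tendsto.mono_left (Continuous.tendsto ?_ p) hg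
          fun_prop
        refine tendsto_nhds_unique a1 (a2.congr fun q => ((hT q).2.1).symm)
      refine ⟨le_of_tendsto_of_tendsto' hp2 ht' fun q => (hT q).1, e1, fun r hr hr' => ?_⟩
      rcases hr.lt_or_eq with hr | rfl
      · rcases hr'.lt_or_eq with hr' | rfl
        · refine le_of_tendsto ((hf.tendsto t').comp ht') ?_
          filter_upwards [hp2.eventually (gt_mem_nhds hr), ht'.eventually (lt_mem_nhds hr')] with q h1 h2
          exact (hT q).2.2 r h1.le h2.le
        · exact le_rfl
      · rw [e1]; exact min_le_left _ _
    have : γ (T p) = γ t' := Runi _ _ _ _ (hT p) hR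
    rw [this]
    exact (γ.continuous.tendsto t').comp ht'
  have self : ∀ s h, f s ≤ h → R s h s := fun s h hs =>
    ⟨le_rfl, by simp [hs], fun r h1 h2 => by rw [le_antisymm h2 h1]⟩
  refine ⟨⟨⟨⟨fun p => γ (T p), hcont⟩, ?_, ?_⟩, ?_⟩⟩
  · intro s
    exact Runi _ _ _ _ (hT (0, s)) (self _ _ (by simpa using hM s))
  · intro s
    obtain ⟨h1', h2', h3'⟩ := hT (1, s)
    have e : f (T (1, s)) = 0 := by rw [h2']; simp [hn]
    have := H (T (1, s)) 1 le_one' (by rw [e, h1]) (fun r _ _ => by rw [e]; exact hn r)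
    simpa using this
  · intro r s hs
    have : f s = 0 := by
      rcases hs with rfl | rfl <;> assumption
    exact Runi _ _ _ _ (hT (r, s)) (self _ _ (by rw [this]; exact hh r))

/-- A loop whose excursions are organised in a laminar family is null-homotopic. -/
theorem null_of_laminar {X : Type*} [TopologicalSpace X] {x0 : X} (γ : Path x0 x0)
    {Q : Type*} [Countable Q] (u : Q → I → ℝ) (uc : ∀ q, Continuous (u q))
    (u0 : ∀ q s, 0 ≤ u q s) (u1 : ∀ q s, u q s ≤ 1)
    (ue0 : ∀ q, u q 0 = 0) (ue1 : ∀ q, u q 1 = 0)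
    (lam : ∀ q q', q ≠ q' → (∀ s, 0 < u q' s → u q s = 1) ∨ (∀ s, 0 < u q s → u q' s = 1) ∨
      (∀ s, 0 < u q s → u q' s = 0))
    (h3 : ∀ q s t, 0 < u q s → u q s < 1 → u q s = u q t → γ s = γ t)
    (h4 : ∀ s, γ s ≠ x0 → ∃ q, 0 < u q s ∧ u q s < 1) :
    γ.Homotopic (Path.refl x0) := by
  obtain ⟨e, he⟩ := exists_injective_nat Q
  let w : Q → ℝ := fun q => (1 / 2 : ℝ) ^ e q
  have wpos : ∀ q, 0 < w q := fun q => by positivity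
  have ws : Summable w := (summable_geometric_of_lt_one (by norm_num) (by norm_num)).comp_injective he
  have ss : ∀ s, Summable fun q => w q * u q s := fun s =>
    Summable.of_nonneg_of_le (fun q => mul_nonneg (wpos q).le (u0 q s))
      (fun q => mul_le_of_le_one_right (wpos q).le (u1 q s)) ws
  let f : I → ℝ := fun s => ∑' q, w q * u q s
  have fc : Continuous f := by
    refine continuous_tsum (fun q => continuous_const.mul (uc q)) ws fun q s => ?_
    rw [Real.norm_of_nonneg (mul_nonneg (wpos q).le (u0 q s))]
    exact mul_le_of_le_one_right (wpos q).le (u1 q s)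
  -- comparison
  have cmp : ∀ q s t, (∀ q', q' ≠ q → u q' t ≤ u q' s) → u q t < u q s → f t < f s := by
    intro q s t h h'
    refine Summable.tsum_lt_tsum (i := q) (fun q' => ?_) ?_ (ss t) (ss s)
    · by_cases hq : q' = q
      · subst hq; exact mul_le_mul_of_nonneg_left h'.le (wpos _).le
      · exact mul_le_mul_of_nonneg_left (h q' hq) (wpos _).le
    · exact mul_lt_mul_of_pos_left h' (wpos _)
  have step : ∀ s t, f s = f t → (∀ r ∈ uIcc s t, f s ≤ f r) → γ s ≠ x0 → γ s = γ t := by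
    intro s t hst hmin hs
    obtain ⟨q, hq0, hq1⟩ := h4 s hs
    -- behaviour of other functions
    have oth : ∀ s' t', 0 < u q s' → u q s' < 1 → 0 < u q t' → ∀ q', q' ≠ q → u q' s' ≤ u q' t' := by
      intro s' t' a b c q' hq'
      rcases lam q q' hq'.symm with h | h | h
      · rcases (u0 q' s').lt_or_eq with h' | h'
        · exact absurd (h s' h') b.ne
        · rw [← h']; exact u0 q' t'
      · rw [h s' a, h t' c]
      · rw [h s' a, h t' c]
    have ht0 : 0 < u q t := by
      by_contra hcon
      have hO : IsOpen {r | 0 < u q r} := isOpen_lt continuous_const (uc q)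
      obtain ⟨e, he, hee⟩ : ∃ e ∈ uIcc s t, e ∈ frontier {r | 0 < u q r} := by
        have hpc : IsPreconnected (uIcc s t) := isPreconnected_uIcc
        by_contra hno
        push Not at hno
        rw [hO.frontier_eq] at hno
        obtain ⟨z, -, hz1, hz2⟩ := hpc {r | 0 < u q r} (closure {r | 0 < u q r})ᶜ hO
          isClosed_closure.isOpen_compl (fun r hr => by
            by_cases h : r ∈ closure {r | 0 < u q r}
            · left
              by_contra h'
              exact hno r hr ⟨h, h'⟩
            · exact Or.inr h) ⟨s, left_mem_uIcc, hq0⟩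
          ⟨t, right_mem_uIcc, fun h => hno t right_mem_uIcc ⟨h, hcon⟩⟩
        exact hz2 (subset_closure hz1)
      rw [hO.frontier_eq] at hee
      have hue : u q e = 0 := le_antisymm (not_lt.1 hee.2) (u0 q e)
      refine absurd (cmp q s e ?_ (by rw [hue]; exact hq0)) (not_lt.2 (hmin e he))
      intro q' hq'
      rcases lam q q' hq'.symm with h | h | h
      · rcases (u0 q' e).lt_or_eq with h' | h'
        · have := h e h'; rw [hue] at this; norm_num at this
        · rw [← h']; exact u0 q' s
      · rw [h s hq0]; exact u1 _ _
      · rcases (u0 q' e).lt_or_eq with h' | h'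
        · have hO' : IsOpen {r | 0 < u q' r} := isOpen_lt continuous_const (uc q')
          obtain ⟨z, hz1, hz2⟩ := mem_closure_iff.1 hee.1 _ hO' h'
          exact absurd (h z hz2) (ne_of_gt hz1)
        · rw [← h']; exact u0 q' s
    have hle : u q t ≤ u q s := by
      by_contra hcon
      push Not at hcon
      exact absurd (cmp q t s (oth s t hq0 hq1 ht0) hcon) (by simp [hst])
    have hle' : u q s ≤ u q t := by
      by_contra hcon
      push Not at hcon
      exact absurd (cmp q s t (oth t s ht0 (hle.trans_lt hq1) hq0) hcon) (by simp [hst])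
    exact h3 q s t hq0 hq1 (le_antisymm hle' hle)
  refine null_of_contour γ f fc (by simp [f, ue0]) (by simp [f, ue1])
    (fun s => tsum_nonneg fun q => mul_nonneg (wpos q).le (u0 q s)) ?_
  intro s t hst hf hmin
  by_cases hs : γ s = x0
  · by_cases ht : γ t = x0
    · rw [hs, ht]
    · refine (step t s hf.symm (fun r hr => ?_) ht).symm
      rw [uIcc_of_ge hst] at hr
      rw [← hf]; exact hmin r hr.1 hr.2
  · refine step s t hf (fun r hr => ?_) hs
    rw [uIcc_of_le hst] at hr
    exact hmin r hr.1 hr.2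

open Set Filter Topology

def HLam (p p' : ℝ × ℝ) : Prop :=
  p.2 < p'.1 ∨ p'.2 < p.1 ∨ (p.1 < p'.1 ∧ p'.2 < p.2) ∨ (p'.1 < p.1 ∧ p.2 < p'.2)

/-- A word that is trivial in the free group admits a non-crossing complete cancellation. -/
theorem exists_noncrossing (c : ℝ → ℕ × Bool) : ∀ (k : ℕ) (L : List ℝ), L.length = k →
    L.Pairwise (· < ·) → FreeGroup.mk (L.map c) = 1 →
    ∃ M : Set (ℝ × ℝ), (∀ p ∈ M, p.1 ∈ L ∧ p.2 ∈ L ∧ p.1 < p.2 ∧ (c p.1).1 = (c p.2).1 ∧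
      (c p.1).2 ≠ (c p.2).2) ∧ (∀ x ∈ L, ∃ p ∈ M, p.1 = x ∨ p.2 = x) ∧
      (∀ p ∈ M, ∀ p' ∈ M, p ≠ p' → HLam p p') := by
  intro k
  induction k using Nat.strong_induction_on with
  | _ k ih =>
  intro L hk hs h
  by_cases hL : L = []
  · subst hL
    exact ⟨∅, by simp, by simp, by simp⟩
  have hnr : ¬ FreeGroup.IsReduced (L.map c) := by
    intro hr
    rw [FreeGroup.one_eq_mk, FreeGroup.Red.exact] at h
    obtain ⟨z, h1, h2⟩ := h
    rw [hr.red_iff_eq] at h1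
    rw [FreeGroup.Red.nil_iff] at h2
    rw [h2] at h1
    exact hL (List.map_eq_nil_iff.1 h1.symm)
  rw [FreeGroup.isReduced_iff_not_step] at hnr
  push Not at hnr
  obtain ⟨W, hW⟩ := hnr
  generalize hV : L.map c = V at hW
  cases hW with
  | @not W1 W2 i b =>
  obtain ⟨L1, R, rfl, rfl, hR⟩ := List.map_eq_append_iff.1 hV
  obtain ⟨x, R', rfl, hx, hR'⟩ := List.map_eq_cons_iff.1 hR
  obtain ⟨y, L2, rfl, hy, rfl⟩ := List.map_eq_cons_iff.1 hR'
  have hsub : (L1 ++ L2).Sublist (L1 ++ x :: y :: L2) := by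
    refine List.Sublist.append_left ?_ _
    exact (List.sublist_cons_self _ _).trans (List.sublist_cons_self _ _)
  have hmk : FreeGroup.mk ((L1 ++ L2).map c) = 1 := by
    rw [← h]
    rw [List.map_append, List.map_append, List.map_cons, List.map_cons, hx, hy]
    exact (Quot.sound FreeGroup.Red.Step.not).symm
  obtain ⟨M, h1, h2, h3⟩ := ih _ (by rw [← hk]; simp) (L1 ++ L2) rfl (hs.sublist hsub) hmk
  rw [List.pairwise_append] at hs
  obtain ⟨hs1, hs2, hs12⟩ := hs
  rw [List.pairwise_cons, List.pairwise_cons] at hs2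
  obtain ⟨hsx, hsy, hs2⟩ := hs2
  have hxy : x < y := hsx y (by simp)
  have cmp : ∀ z ∈ L1 ++ L2, z < x ∨ y < z := by
    intro z hz
    rcases List.mem_append.1 hz with hz | hz
    · exact Or.inl (hs12 z hz x (by simp))
    · exact Or.inr (hsy z hz)
  have new : ∀ p ∈ M, HLam p (x, y) := by
    intro p hp
    obtain ⟨a1, a2, a3, -⟩ := h1 p hp
    unfold HLam
    rcases cmp _ a1 with b1 | b1 <;> rcases cmp _ a2 with b2 | b2 <;> simp only
    · exact Or.inl b2
    · exact Or.inr (Or.inr (Or.inl ⟨b1, b2⟩))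
    · linarith
    · exact Or.inr (Or.inl b1)
  have hsymm : ∀ p p', HLam p p' → HLam p' p := by
    intro p p' h
    unfold HLam at *
    tauto
  refine ⟨insert (x, y) M, ?_, ?_, ?_⟩
  · rintro p (rfl | hp)
    · refine ⟨by simp, by simp, hxy, ?_, ?_⟩ <;> simp [hx, hy]
    · obtain ⟨a1, a2, a3⟩ := h1 p hp
      exact ⟨hsub.subset a1, hsub.subset a2, a3⟩
  · intro z hz
    have : z = x ∨ z = y ∨ z ∈ L1 ++ L2 := by
      simp only [List.mem_append, List.mem_cons] at hz ⊢
      tauto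
    rcases this with rfl | rfl | hz
    · exact ⟨_, mem_insert _ _, Or.inl rfl⟩
    · exact ⟨_, mem_insert _ _, Or.inr rfl⟩
    · obtain ⟨p, hp, hp'⟩ := h2 z hz
      exact ⟨p, mem_insert_of_mem _ hp, hp'⟩
  · rintro p (rfl | hp) p' (rfl | hp') hne
    · exact absurd rfl hne
    · exact hsymm _ _ (new _ hp')
    · exact new _ hp
    · exact h3 p hp p' hp' hne

/-- total exponent of the letter `1` -/
def hTau : FreeGroup ℕ →* Multiplicative ℤ :=
  FreeGroup.lift fun i => if i = 1 then Multiplicative.ofAdd 1 else 1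

def hT (x : FreeGroup ℕ) : ℤ := (hTau x).toAdd

lemma hT_mul (x y) : hT (x * y) = hT x + hT y := by simp [hT]
lemma hT_inv (x) : hT (x⁻¹) = - hT x := by simp [hT]
lemma hT_one : hT 1 = 0 := by simp [hT]
lemma hT_of (i) : hT (FreeGroup.of i) = if i = 1 then 1 else 0 := by
  unfold hT hTau; split_ifs <;> simp_all

/-- truncated left multiplication -/
noncomputable def hGen (i : ℕ) : Equiv.Perm (FreeGroup ℕ) :=
  if h : i = 1 then Equiv.mulLeft (FreeGroup.of 1) else
    { toFun := fun y => if (i : ℤ) ≤ hT y then FreeGroup.of i * y else y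
      invFun := fun y => if (i : ℤ) ≤ hT y then (FreeGroup.of i)⁻¹ * y else y
      left_inv := fun y => by
        by_cases hy : (i : ℤ) ≤ hT y
        · simp [hy, hT_mul, hT_of, h]
        · simp [hy]
      right_inv := fun y => by
        by_cases hy : (i : ℤ) ≤ hT y
        · simp [hy, hT_mul, hT_of, hT_inv, h]
        · simp [hy] }

noncomputable def hAct : FreeGroup ℕ →* Equiv.Perm (FreeGroup ℕ) := FreeGroup.lift hGen

/-- kill the letters of index `> n` -/
def hProj (n : ℕ) : FreeGroup ℕ →* FreeGroup ℕ :=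
  FreeGroup.lift fun i => if i ≤ n then FreeGroup.of i else 1

lemma hProj_of (n i : ℕ) : hProj n (FreeGroup.of i) = if i ≤ n then FreeGroup.of i else 1 := by
  simp [hProj]

def hCnt (L : List (ℕ × Bool)) : ℕ := L.countP (fun a => a.1 = 1)

lemma mk_cons_eq (i : ℕ) (b : Bool) (L) : (FreeGroup.mk ((i, b) :: L) : FreeGroup ℕ) =
    (if b then FreeGroup.of i else (FreeGroup.of i)⁻¹) * FreeGroup.mk L := by
  cases b
  · simp [FreeGroup.of, FreeGroup.inv_mk, FreeGroup.invRev]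
  · simp [FreeGroup.of]

lemma hCnt_cons (i : ℕ) (b : Bool) (L) : hCnt ((i, b) :: L) = hCnt L + if i = 1 then 1 else 0 := by
  simp [hCnt, List.countP_cons]

lemma hAct_letter (i : ℕ) (b : Bool) (y : FreeGroup ℕ) :
    hAct (if b then FreeGroup.of i else (FreeGroup.of i)⁻¹) y =
      if i = 1 ∨ (i : ℤ) ≤ hT y then (if b then FreeGroup.of i else (FreeGroup.of i)⁻¹) * y else y := by
  cases b
  · by_cases h : i = 1
    · subst h
      simp [hAct, hGen]
    · simp only [hAct, Bool.false_eq_true, ↓reduceIte, map_inv, FreeGroup.lift_apply_of, h, false_or]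
      simp only [hGen, h, dite_false]
      rfl
  · by_cases h : i = 1
    · subst h
      simp [hAct, hGen]
    · simp [hAct, hGen, h]

lemma hT_letter (i : ℕ) (b : Bool) :
    hT (if b then FreeGroup.of i else (FreeGroup.of i)⁻¹) =
      if i = 1 then (if b then 1 else -1) else 0 := by
  cases b <;> by_cases h : i = 1 <;> simp [hT_inv, hT_of, h]

lemma hProj_letter (n i : ℕ) (b : Bool) :
    hProj n (if b then FreeGroup.of i else (FreeGroup.of i)⁻¹) =
      if i ≤ n then (if b then FreeGroup.of i else (FreeGroup.of i)⁻¹) else 1 := by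
  cases b <;> by_cases h : i ≤ n <;> simp [hProj_of, h]

lemma hAct_bound (L : List (ℕ × Bool)) (y : FreeGroup ℕ) :
    hT y - hCnt L ≤ hT (hAct (FreeGroup.mk L) y) ∧ hT (hAct (FreeGroup.mk L) y) ≤ hT y + hCnt L := by
  induction L with
  | nil => simp [← FreeGroup.one_eq_mk, hCnt]
  | cons a L ih =>
    obtain ⟨i, b⟩ := a
    rw [mk_cons_eq, map_mul, Equiv.Perm.mul_apply, hAct_letter, hCnt_cons]
    generalize hAct (FreeGroup.mk L) y = z at ih ⊢
    by_cases h1 : i = 1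
    · rw [if_pos (Or.inl h1), hT_mul, hT_letter, if_pos h1, if_pos h1]
      push_cast
      split_ifs <;> constructor <;> linarith
    · by_cases h2 : i = 1 ∨ (i : ℤ) ≤ hT z
      · rw [if_pos h2, hT_mul, hT_letter, if_neg h1, if_neg h1]
        simpa using ih
      · rw [if_neg h2, if_neg h1]
        simpa using ih

lemma hAct_stab (N : ℕ) (hN : 1 ≤ N) (L : List (ℕ × Bool)) (y : FreeGroup ℕ)
    (h : hT y + hCnt L ≤ N) : hAct (hProj N (FreeGroup.mk L)) y = hAct (FreeGroup.mk L) y := by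
  induction L with
  | nil => simp [← FreeGroup.one_eq_mk]
  | cons a L ih =>
    obtain ⟨i, b⟩ := a
    rw [hCnt_cons] at h
    have h' : hT y + hCnt L ≤ N := by push_cast at h; split_ifs at h <;> linarith
    rw [mk_cons_eq, map_mul, map_mul, map_mul, Equiv.Perm.mul_apply, Equiv.Perm.mul_apply, ih h',
      hProj_letter]
    by_cases hi : i ≤ N
    · rw [if_pos hi]
    · rw [if_neg hi, map_one, Equiv.Perm.one_apply, hAct_letter, if_neg]
      have := (hAct_bound L y).2
      push Not
      exact ⟨by omega, by omega⟩

lemma hAct_core (n : ℕ) (hn : 1 ≤ n) (L : List (ℕ × Bool)) (y : FreeGroup ℕ)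
    (h : n + hCnt L ≤ hT y) :
    hProj n (hAct (FreeGroup.mk L) y) = hProj n (FreeGroup.mk L) * hProj n y := by
  induction L with
  | nil => simp [← FreeGroup.one_eq_mk]
  | cons a L ih =>
    obtain ⟨i, b⟩ := a
    rw [hCnt_cons] at h
    have h' : n + hCnt L ≤ hT y := by push_cast at h; split_ifs at h <;> linarith
    rw [mk_cons_eq, map_mul, Equiv.Perm.mul_apply, map_mul, mul_assoc, ← ih h', hAct_letter]
    by_cases h1 : i = 1 ∨ (i : ℤ) ≤ hT (hAct (FreeGroup.mk L) y)
    · rw [if_pos h1, map_mul]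
    · rw [if_neg h1]
      have := (hAct_bound L y).1
      push Not at h1
      rw [hProj_letter, if_neg (by omega), one_mul]

/-- representable by a word with at most `m` letters of index `1` -/
def hTC (m : ℕ) (x : FreeGroup ℕ) : Prop := ∃ L, FreeGroup.mk L = x ∧ hCnt L ≤ m

lemma hTC_mul {m m' : ℕ} {x x'} (h : hTC m x) (h' : hTC m' x') : hTC (m + m') (x * x') := by
  obtain ⟨L, rfl, hL⟩ := h
  obtain ⟨L', rfl, hL'⟩ := h'
  refine ⟨L ++ L', by simp, ?_⟩
  unfold hCnt at *
  rw [List.countP_append]; omega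

lemma hTC_inv {m : ℕ} {x} (h : hTC m x) : hTC m (x⁻¹) := by
  obtain ⟨L, rfl, hL⟩ := h
  refine ⟨FreeGroup.invRev L, by simp [FreeGroup.inv_mk], ?_⟩
  unfold hCnt at *
  simp only [FreeGroup.invRev, List.countP_reverse, List.countP_map]
  exact hL

lemma hTC_one : hTC 0 1 := ⟨[], by simp [FreeGroup.one_eq_mk], by simp [hCnt]⟩

lemma hTC_mono {m m' : ℕ} {x} (h : hTC m x) (hm : m ≤ m') : hTC m' x := by
  obtain ⟨L, h1, h2⟩ := h
  exact ⟨L, h1, h2.trans hm⟩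

lemma hTC_of (i : ℕ) : hTC 1 (FreeGroup.of i) := ⟨[(i, true)], rfl, by simp [hCnt]; split_ifs <;> simp⟩

/-- subgroup generated by letters other than `1` -/
def hB : Subgroup (FreeGroup ℕ) := Subgroup.closure {x | ∃ i, i ≠ 1 ∧ x = FreeGroup.of i}

lemma hTC_hB {x} (h : x ∈ hB) : hTC 0 x := by
  induction h using Subgroup.closure_induction with
  | mem x hx => obtain ⟨i, hi, rfl⟩ := hx; exact ⟨[(i, true)], rfl, by simp [hCnt, hi]⟩
  | one => exact hTC_one
  | mul x y _ _ hx hy => exact hTC_mul hx hy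
  | inv x _ hx => exact hTC_inv hx

open Set Filter Topology unitInterval

noncomputable section HawaiianGeometry

abbrev HE := HawaiianEarring

def hX (p : HE) : ℝ := p.1.1
def hY (p : HE) : ℝ := p.1.2
def hR (p : HE) : ℝ := hX p ^ 2 + hY p ^ 2
def hIdx (p : HE) : ℕ := ⌊2 * hY p / hR p⌋₊

lemma hX_cont : Continuous hX := continuous_fst.comp continuous_subtype_val
lemma hY_cont : Continuous hY := continuous_snd.comp continuous_subtype_val
lemma hR_cont : Continuous hR := (hX_cont.pow 2).add (hY_cont.pow 2)

lemma he_ext {p q : HE} (h1 : hX p = hX q) (h2 : hY p = hY q) : p = q :=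
  Subtype.ext (Prod.ext h1 h2)

lemma hX_base : hX hawaiianBasepoint = 0 := rfl
lemma hY_base : hY hawaiianBasepoint = 0 := rfl
lemma hR_base : hR hawaiianBasepoint = 0 := by simp [hR, hX_base, hY_base]
lemma hIdx_base : hIdx hawaiianBasepoint = 0 := by simp [hIdx, hR_base]

lemma hR_nonneg (p : HE) : 0 ≤ hR p := by unfold hR; positivity

lemma hR_eq_zero {p : HE} : hR p = 0 ↔ p = hawaiianBasepoint := by
  constructor
  · intro h
    unfold hR at h
    have h1 : hX p = 0 := by nlinarith [sq_nonneg (hX p), sq_nonneg (hY p)]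
    have h2 : hY p = 0 := by nlinarith [sq_nonneg (hX p), sq_nonneg (hY p)]
    exact he_ext h1 h2
  · rintro rfl; exact hR_base

lemma hR_pos {p : HE} (h : p ≠ hawaiianBasepoint) : 0 < hR p :=
  lt_of_le_of_ne (hR_nonneg p) fun h' => h (hR_eq_zero.1 h'.symm)

lemma he_circle (p : HE) : ∃ i : ℕ, 1 ≤ i ∧ (i : ℝ) * hR p = 2 * hY p := by
  obtain ⟨i, hi, hp⟩ := mem_iUnion₂.1 p.2
  refine ⟨i, hi, ?_⟩
  have hp : hX p ^ 2 + (hY p - 1 / (i : ℝ)) ^ 2 = (1 / (i : ℝ)) ^ 2 := hp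
  have hi0 : (i : ℝ) ≠ 0 := by
    have : 1 ≤ i := hi
    positivity
  unfold hR
  field_simp at hp
  have h2 : (i : ℝ) * (i * (hX p ^ 2 + hY p ^ 2) - 2 * hY p) = 0 := by linarith
  rcases mul_eq_zero.1 h2 with h | h
  · exact absurd h hi0
  · linarith

lemma hIdx_of {p : HE} (h : p ≠ hawaiianBasepoint) {i : ℕ} (hi : (i : ℝ) * hR p = 2 * hY p) :
    hIdx p = i := by
  unfold hIdx
  rw [← hi, mul_div_cancel_right₀ _ (hR_pos h).ne', Nat.floor_natCast]

lemma hIdx_eq (p : HE) : (hIdx p : ℝ) * hR p = 2 * hY p := by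
  by_cases h : p = hawaiianBasepoint
  · subst h; simp [hR_base, hY_base]
  · obtain ⟨i, hi, hp⟩ := he_circle p
    rw [hIdx_of h hp, hp]

lemma hIdx_pos {p : HE} (h : p ≠ hawaiianBasepoint) : 1 ≤ hIdx p := by
  obtain ⟨i, hi, hp⟩ := he_circle p
  rw [hIdx_of h hp]; exact hi

lemma hIdx_div {p : HE} (h : p ≠ hawaiianBasepoint) : (hIdx p : ℝ) = 2 * hY p / hR p := by
  rw [eq_div_iff (hR_pos h).ne', hIdx_eq]

lemma hY_nonneg (p : HE) : 0 ≤ hY p := by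
  have := hIdx_eq p
  have h2 : 0 ≤ (hIdx p : ℝ) * hR p := mul_nonneg (Nat.cast_nonneg _) (hR_nonneg p)
  linarith

lemma ne_base_nhds {p : HE} (h : p ≠ hawaiianBasepoint) : ∀ᶠ q in 𝓝 p, q ≠ hawaiianBasepoint :=
  isOpen_ne.mem_nhds h

lemma hIdx_nhds {p : HE} (h : p ≠ hawaiianBasepoint) : ∀ᶠ q in 𝓝 p, hIdx q = hIdx p := by
  have hc : ContinuousAt (fun q => 2 * hY q / hR q) p :=
    ContinuousAt.div (continuousAt_const.mul hY_cont.continuousAt) hR_cont.continuousAt (hR_pos h).ne'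
  have := hc.eventually (Metric.ball_mem_nhds _ (zero_lt_one))
  filter_upwards [this, ne_base_nhds h] with q hq hq'
  rw [← hIdx_div h, ← hIdx_div hq', Real.dist_eq, abs_lt] at hq
  have h1 : hIdx p < hIdx q + 1 := by
    have := hq.1
    have : (hIdx p : ℝ) < hIdx q + 1 := by linarith
    exact_mod_cast this
  have h2 : hIdx q < hIdx p + 1 := by
    have := hq.2
    have : (hIdx q : ℝ) < hIdx p + 1 := by linarith
    exact_mod_cast this
  omega

def hA (n : ℕ) : Set HE := {p | 2 * hY p < (n + 1 / 2) * hR p}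
def hU (n : ℕ) : Set HE := {p | hX p ≠ 0 ∨ hY p < 2 / (n + 1 / 2)}

lemma hA_open (n) : IsOpen (hA n) :=
  isOpen_lt (continuous_const.mul hY_cont) (continuous_const.mul hR_cont)

lemma hU_open (n) : IsOpen (hU n) :=
  (isOpen_ne_fun hX_cont continuous_const).union (isOpen_lt hY_cont continuous_const)

lemma mem_hA {n : ℕ} {p : HE} : p ∈ hA n ↔ p ≠ hawaiianBasepoint ∧ hIdx p ≤ n := by
  by_cases h : p = hawaiianBasepoint
  · subst h; simp [hA, hR_base, hY_base]
  · simp only [hA, mem_ofPred_eq, ← hIdx_eq, ne_eq, h, not_false_iff, true_and]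
    rw [mul_lt_mul_iff_left₀ (hR_pos h)]
    constructor
    · intro h'
      have : (hIdx p : ℝ) < n + 1 := by linarith
      have : hIdx p < n + 1 := by exact_mod_cast this
      omega
    · intro h'
      have : (hIdx p : ℝ) ≤ n := by exact_mod_cast h'
      linarith

lemma base_not_mem_hA (n) : hawaiianBasepoint ∉ hA n := by simp [mem_hA]

lemma hA_compl_subset {n : ℕ} {p : HE} (h : p ∉ hA n) : p ∈ hU n := by
  by_cases hx : hX p = 0
  · right
    simp only [hA, mem_ofPred_eq, not_lt, hR, hx] at h
    have hn : (0 : ℝ) < n + 1 / 2 := by positivity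
    rw [lt_div_iff₀ hn]
    by_cases hy : hY p = 0
    · simp [hy]
    · have hy' : 0 < hY p := lt_of_le_of_ne (hY_nonneg p) (Ne.symm hy)
      have h1 : (n + 1 / 2) * hY p ≤ 2 := by
        by_contra hc
        push Not at hc
        nlinarith
      rcases h1.lt_or_eq with h2 | h2
      · linarith
      · exfalso
        have h3 := hIdx_eq p
        simp only [hR, hx] at h3
        have h4 : (hIdx p : ℝ) * hY p = 2 := by
          have : hY p * ((hIdx p : ℝ) * hY p - 2) = 0 := by nlinarith
          rcases mul_eq_zero.1 this with h | h
          · exact absurd h hy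
          · linarith
        have h5 : (hIdx p : ℝ) = n + 1 / 2 := by
          have : hY p * ((hIdx p : ℝ) - (n + 1 / 2)) = 0 := by linarith
          rcases mul_eq_zero.1 this with h | h
          · exact absurd h hy
          · linarith
        have h6 : 2 * hIdx p = 2 * n + 1 := by
          have : (2 : ℝ) * hIdx p = 2 * n + 1 := by linarith
          exact_mod_cast this
        omega
  · exact Or.inl hx

lemma hU_inter_hA {n : ℕ} {p : HE} (h : p ∈ hU n) (h' : p ∈ hA n) : hX p ≠ 0 := by
  rcases h with h | h
  · exact h
  · intro hx
    simp only [hA, mem_ofPred_eq, hR, hx] at h'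
    have hn : (0 : ℝ) < n + 1 / 2 := by positivity
    rw [lt_div_iff₀ hn] at h
    nlinarith [hY_nonneg p]

lemma hU_anti {n N : ℕ} (h : n ≤ N) : hU N ⊆ hU n := by
  rintro p (hp | hp)
  · exact Or.inl hp
  · refine Or.inr (hp.trans_le ?_)
    have : (n : ℝ) ≤ N := by exact_mod_cast h
    gcongr

open Classical in
def hEta (n : ℕ) (p : HE) : FreeGroup ℕ :=
  if p ∈ hA n ∧ 0 < hX p then FreeGroup.of (hIdx p) else 1

lemma hEta_of_not {n p} (h : p ∉ hA n) : hEta n p = 1 := by simp [hEta, h]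

lemma hEta_nhds {n : ℕ} {p : HE} (h : p ∈ hU n) (h' : p ∈ hA n) :
    ∀ᶠ q in 𝓝 p, hEta n q = hEta n p := by
  have hx := hU_inter_hA h h'
  have e1 : ∀ᶠ q in 𝓝 p, (0 < hX q ↔ 0 < hX p) := by
    rcases lt_or_gt_of_ne hx with hx | hx
    · filter_upwards [hX_cont.continuousAt.eventually (gt_mem_nhds hx)] with q hq
      constructor <;> intro <;> linarith
    · filter_upwards [hX_cont.continuousAt.eventually (lt_mem_nhds hx)] with q hq
      constructor <;> intro <;> linarith
  filter_upwards [e1, (hA_open n).mem_nhds h', hIdx_nhds (mem_hA.1 h').1] with q h1 h2 h3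
  simp only [hEta, h', h2, h1, h3]

/-- development of a map `γ` in the `n`-th free group -/
def HDev {T : Type*} [TopologicalSpace T] (n : ℕ) (γ : T → HE) (g : T → FreeGroup ℕ) : Prop :=
  ∀ t, (γ t ∈ hA n → ∀ᶠ s in 𝓝 t, g s = g t) ∧
    (γ t ∉ hA n → ∀ᶠ s in 𝓝 t, g s = g t * hEta n (γ s))

section Dev
variable {T : Type*} [TopologicalSpace T] {n : ℕ} {γ : T → HE} {g g' : T → FreeGroup ℕ}

lemma HDev.hU (hγ : Continuous γ) (h : HDev n γ g) {t : T} (ht : γ t ∈ hU n) :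
    ∀ᶠ s in 𝓝 t, g s * (hEta n (γ s))⁻¹ = g t * (hEta n (γ t))⁻¹ := by
  by_cases h' : γ t ∈ hA n
  · filter_upwards [(h t).1 h', hγ.continuousAt.eventually (hEta_nhds ht h')] with s h1 h2
    rw [h1, h2]
  · filter_upwards [(h t).2 h'] with s h1
    rw [h1, hEta_of_not h']; simp

lemma HDev.comp (h : HDev n γ g) {S : Type*} [TopologicalSpace S] {φ : S → T} (hφ : Continuous φ) :
    HDev n (γ ∘ φ) (g ∘ φ) := fun s =>
  ⟨fun h' => hφ.continuousAt.eventually ((h (φ s)).1 h'),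
   fun h' => hφ.continuousAt.eventually ((h (φ s)).2 h')⟩

lemma HDev.mul (h : HDev n γ g) (c : FreeGroup ℕ) : HDev n γ (fun t => c * g t) := fun t =>
  ⟨fun h' => ((h t).1 h').mono fun s hs => by dsimp only; rw [hs],
   fun h' => ((h t).2 h').mono fun s hs => by dsimp only; rw [hs, mul_assoc]⟩

lemma HDev.unique [PreconnectedSpace T] (h : HDev n γ g) (h' : HDev n γ g') (s t : T) :
    g s * (g' s)⁻¹ = g t * (g' t)⁻¹ := by
  have : IsLocallyConstant fun t => g t * (g' t)⁻¹ := by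
    rw [IsLocallyConstant.iff_eventually_eq]
    intro t
    by_cases ht : γ t ∈ hA n
    · filter_upwards [(h t).1 ht, (h' t).1 ht] with s h1 h2
      rw [h1, h2]
    · filter_upwards [(h t).2 ht, (h' t).2 ht] with s h1 h2
      rw [h1, h2]; group
  exact this.apply_eq_of_isPreconnected isPreconnected_univ (mem_univ s) (mem_univ t)

lemma HDev.eq [PreconnectedSpace T] (h : HDev n γ g) (h' : HDev n γ g') (s : T) (hs : g s = g' s) :
    g = g' := by
  funext t
  have := h.unique h' s t
  rw [hs, mul_inv_cancel] at this
  exact (mul_inv_eq_one.1 this.symm)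

lemma HDev.proj (hγ : Continuous γ) {N : ℕ} (h : HDev N γ g) (hn : n ≤ N) :
    HDev n γ (fun t => hProj n (g t)) := by
  have hsub : ∀ p, p ∈ hA n → p ∈ hA N := fun p hp =>
    mem_hA.2 ⟨(mem_hA.1 hp).1, (mem_hA.1 hp).2.trans hn⟩
  have heta : ∀ p, hProj n (hEta N p) = hEta n p := by
    intro p
    by_cases h1 : p ∈ hA n
    · by_cases h2 : 0 < hX p
      · simp [hEta, h1, hsub p h1, h2, hProj_of, (mem_hA.1 h1).2]
      · simp [hEta, h2]
    · rw [hEta_of_not h1]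
      by_cases h3 : p ∈ hA N ∧ 0 < hX p
      · simp only [hEta, if_pos h3, hProj_of]
        rw [if_neg]
        intro h4
        exact h1 (mem_hA.2 ⟨(mem_hA.1 h3.1).1, h4⟩)
      · simp [hEta, if_neg h3]
  intro t
  refine ⟨fun ht => ((h t).1 (hsub _ ht)).mono fun s hs => by dsimp only; rw [hs], fun ht => ?_⟩
  by_cases ht' : γ t ∈ hA N
  · have hi : n < hIdx (γ t) := by
      by_contra hc
      exact ht (mem_hA.2 ⟨(mem_hA.1 ht').1, not_lt.1 hc⟩)
    filter_upwards [(h t).1 ht', hγ.continuousAt.eventually (hIdx_nhds (mem_hA.1 ht').1)] with s h1 h2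
    rw [h1, hEta_of_not, mul_one]
    intro h3
    have := (mem_hA.1 h3).2
    omega
  · filter_upwards [(h t).2 ht'] with s h1
    rw [h1, map_mul, heta]

end Dev

instance freeGroupTop : TopologicalSpace (FreeGroup ℕ) := ⊥
instance freeGroupDisc : DiscreteTopology (FreeGroup ℕ) := ⟨rfl⟩

def hE (n : ℕ) (b : Bool) (x : HE) : FreeGroup ℕ := if b then hEta n x else 1

open Classical in
def hCore (n : ℕ) : FiberBundleCore Bool HE (FreeGroup ℕ) where
  baseSet b := if b then hU n else hA n
  isOpen_baseSet b := by
    cases b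
    · simpa using hA_open n
    · simpa using hU_open n
  indexAt x := if x ∈ hA n then false else true
  mem_baseSet_at x := by
    by_cases h : x ∈ hA n
    · simp [h]
    · simpa [h] using hA_compl_subset h
  coordChange i j x v := v * hE n i x * (hE n j x)⁻¹
  coordChange_self i x _ v := by simp
  continuousOn_coordChange i j := by
    have key : ContinuousOn (fun x : HE => hE n i x * (hE n j x)⁻¹)
        ((if i then hU n else hA n) ∩ (if j then hU n else hA n)) := by
      have hc : ContinuousOn (hEta n) (hU n ∩ hA n) := by
        intro x hx
        apply ContinuousAt.continuousWithinAt
        rw [ContinuousAt, nhds_discrete (FreeGroup ℕ), tendsto_pure]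
        exact hEta_nhds hx.1 hx.2
      have hc' : ContinuousOn (fun x => (hEta n x)⁻¹) (hA n ∩ hU n) := by
        rw [inter_comm]
        exact (continuous_of_discreteTopology : Continuous (fun v : FreeGroup ℕ => v⁻¹)).comp_continuousOn hc
      cases i <;> cases j
      · simp [hE]; exact continuousOn_const
      · simpa [hE] using hc'
      · simpa [hE] using hc
      · simp [hE]; exact continuousOn_const
    have h2 : ContinuousOn (fun p : HE × FreeGroup ℕ => (p.2, hE n i p.1 * (hE n j p.1)⁻¹))
        (((if i then hU n else hA n) ∩ (if j then hU n else hA n)) ×ˢ univ) :=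
      continuousOn_snd.prodMk (key.comp continuousOn_fst fun p hp => hp.1)
    have h3 := (continuous_of_discreteTopology
      (f := fun v : FreeGroup ℕ × FreeGroup ℕ => v.1 * v.2)).comp_continuousOn h2
    refine h3.congr fun p _ => ?_
    simp [mul_assoc]
  coordChange_comp i j k x _ v := by group

theorem hdev_exists {A : Type*} [TopologicalSpace A] (n : ℕ) (H : C(I × A, HE))
    (h0 : ∀ a, H (0, a) = hawaiianBasepoint) :
    ∃ g : I × A → FreeGroup ℕ, HDev n H g ∧ ∀ a, g (0, a) = 1 := by
  have cov : IsCoveringMap (hCore n).proj :=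
    FiberBundle.isCoveringMap (F := FreeGroup ℕ) (E := (hCore n).Fiber)
  let f : C(A, (hCore n).TotalSpace) := ContinuousMap.const A ⟨hawaiianBasepoint, (1 : FreeGroup ℕ)⟩
  have H0 : ∀ a, H (0, a) = (hCore n).proj (f a) := fun a => h0 a
  let Γ := cov.liftHomotopy H f H0
  have hΓ : ∀ p, (Γ p).1 = H p := fun p => congrFun (cov.liftHomotopy_lifts H f H0) p
  have hΓ0 : ∀ a, Γ (0, a) = f a := fun a => cov.liftHomotopy_zero H f H0 a
  obtain ⟨G, hG⟩ : ∃ G : I × A → FreeGroup ℕ, ∀ p, G p = (Γ p).2 := ⟨_, fun _ => rfl⟩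
  have key : ∀ (i : Bool) (t : I × A), H t ∈ (hCore n).baseSet i → ∀ᶠ s in 𝓝 t,
      (hCore n).coordChange ((hCore n).indexAt (H s)) i (H s) (G s)
       = (hCore n).coordChange ((hCore n).indexAt (H t)) i (H t) (G t) := by
    intro i t ht
    have hs : Γ t ∈ ((hCore n).localTriv i).source := by
      rw [(hCore n).mem_localTriv_source, hΓ]; exact ht
    have hc : ContinuousAt ((hCore n).localTriv i) (Γ t) :=
      ((hCore n).localTriv i).continuousAt hs
    have hc2 : ContinuousAt (fun s => (((hCore n).localTriv i (Γ s)).2 : FreeGroup ℕ)) t :=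
      continuousAt_snd.comp (hc.comp Γ.continuous.continuousAt)
    rw [ContinuousAt, nhds_discrete (FreeGroup ℕ), tendsto_pure] at hc2
    simp only [hG, ← hΓ]
    exact hc2
  refine ⟨G, fun t => ⟨fun ht => ?_, fun ht => ?_⟩, fun a => ?_⟩
  · have k := key false t (by change H t ∈ (if false = true then hU n else hA n); simpa using ht)
    filter_upwards [k, H.continuous.continuousAt.eventually ((hA_open n).mem_nhds ht)] with s h1 h2
    have h2 : H s ∈ hA n := h2
    simp only [hCore, ht, h2, if_true, hE] at h1
    simpa using h1
  · have k := key true t (by change H t ∈ (if true = true then hU n else hA n); simpa using hA_compl_subset ht)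
    filter_upwards [k] with s h1
    simp only [hCore, ht, if_false, hE, if_true, hEta_of_not ht] at h1
    by_cases h2 : H s ∈ hA n
    · simp [h2] at h1
      rw [mul_inv_eq_iff_eq_mul] at h1
      exact h1
    · simp [h2] at h1
      rw [hEta_of_not h2]
      simpa using h1
  · rw [hG, hΓ0]; rfl
end HawaiianGeometry

open Set Filter Topology unitInterval

noncomputable section HawaiianHom

lemma const_of_eventually {T X : Type*} [TopologicalSpace T] {s : Set T} (hs : IsPreconnected s)
    (f : T → X) (h : ∀ t ∈ s, ∀ᶠ x in 𝓝 t, f x = f t) {a b : T} (ha : a ∈ s) (hb : b ∈ s) :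
    f a = f b := by
  let _ : TopologicalSpace X := ⊥
  have : DiscreteTopology X := ⟨rfl⟩
  refine hs.constant (f := f) (fun t ht => ContinuousAt.continuousWithinAt ?_) ha hb
  rw [ContinuousAt, nhds_discrete X, tendsto_pure]
  exact h t ht

lemma dev_path (n : ℕ) (γ : Path hawaiianBasepoint hawaiianBasepoint) : ∃ g : I → FreeGroup ℕ, HDev n γ g ∧ g 0 = 1 := by
  obtain ⟨g, hg, h0⟩ := hdev_exists (A := Unit) n
    ((γ : C(I, HE)).comp ⟨Prod.fst, continuous_fst⟩) (fun a => by simp)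
  exact ⟨g ∘ fun s => (s, ()), hg.comp (φ := fun s : I => (s, ())) (by fun_prop), h0 ()⟩

def hPhi (n : ℕ) (γ : Path hawaiianBasepoint hawaiianBasepoint) : FreeGroup ℕ := (dev_path n γ).choose 1

lemma hPhi_eq {n : ℕ} {γ : Path hawaiianBasepoint hawaiianBasepoint} {g : I → FreeGroup ℕ} (h : HDev n γ g) (h0 : g 0 = 1) :
    hPhi n γ = g 1 := by
  obtain ⟨h1, h2⟩ := (dev_path n γ).choose_spec
  exact congrFun (h1.eq h 0 (h2.trans h0.symm)) 1

lemma hPhi_locconst {A : Type*} [TopologicalSpace A] (n : ℕ) (Γ : A → Path hawaiianBasepoint hawaiianBasepoint)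
    (hc : Continuous fun p : I × A => Γ p.2 p.1) (a : A) :
    ∀ᶠ a' in 𝓝 a, hPhi n (Γ a') = hPhi n (Γ a) := by
  obtain ⟨g, hg, h0⟩ := hdev_exists n (⟨_, hc⟩ : C(I × A, HE)) (fun a => by simp)
  have key : ∀ a, hPhi n (Γ a) = g (1, a) := fun a =>
    hPhi_eq (g := g ∘ fun s => (s, a)) (hg.comp (φ := fun s : I => (s, a)) (by fun_prop)) (h0 a)
  have h1 := (hg (1, a)).2 (by simpa using base_not_mem_hA n)
  have h2 : Tendsto (fun a' : A => ((1 : I), a')) (𝓝 a) (𝓝 (1, a)) :=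
    (Continuous.prodMk_right (1 : I)).continuousAt
  filter_upwards [h2.eventually h1] with a' ha'
  rw [key, key, ha']
  simp [hEta_of_not (base_not_mem_hA n)]

lemma hPhi_homotopic (n : ℕ) {γ γ' : Path hawaiianBasepoint hawaiianBasepoint} (h : γ.Homotopic γ') : hPhi n γ = hPhi n γ' := by
  obtain ⟨H⟩ := h
  have := const_of_eventually (isPreconnected_univ (α := I)) (fun a => hPhi n (H.eval a))
    (fun a _ => hPhi_locconst n H.eval (H.continuous.comp continuous_swap) a)
    (mem_univ 0) (mem_univ 1)
  simpa using this

lemma hPhi_nhds (n : ℕ) (γ : Path hawaiianBasepoint hawaiianBasepoint) : ∀ᶠ β in 𝓝 γ, hPhi n β = hPhi n γ :=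
  hPhi_locconst n id (by simp only [id]; fun_prop) γ

lemma hPhi_trans (n : ℕ) (γ γ' : Path hawaiianBasepoint hawaiianBasepoint) : hPhi n (γ.trans γ') = hPhi n γ * hPhi n γ' := by
  obtain ⟨g, hg, h0⟩ := dev_path n (γ.trans γ')
  let φ1 : I → I := fun s => ⟨s / 2, by constructor <;> linarith [s.2.1, s.2.2]⟩
  let φ2 : I → I := fun s => ⟨(1 + s) / 2, by constructor <;> linarith [s.2.1, s.2.2]⟩
  have c1 : Continuous φ1 := by fun_prop
  have c2 : Continuous φ2 := by fun_prop
  have e1 : (γ.trans γ') ∘ φ1 = γ := by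
    funext s
    simp only [Function.comp, Path.trans_apply, φ1]
    rw [dif_pos (by linarith [s.2.2])]
    congr 1; ext; simp; ring
  have e2 : (γ.trans γ') ∘ φ2 = γ' := by
    funext s
    simp only [Function.comp, Path.trans_apply, φ2]
    split_ifs with h
    · have hs : s = 0 := by exact Subtype.ext (by have := s.2.1; simp only [Icc.coe_zero]; linarith)
      subst hs
      have : (⟨2 * ((1 + ((0 : I) : ℝ)) / 2), (unitInterval.mul_pos_mem_iff zero_lt_two).2 ⟨by simp, h⟩⟩ : I) = 1 := by
        ext; simp
      rw [γ'.source]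
      refine Eq.trans ?_ γ.target
      congr 1
    · congr 1; ext; simp; ring
  have d1 : HDev n γ (g ∘ φ1) := by
    have := hg.comp c1
    rwa [e1] at this
  have d2 : HDev n γ' (fun t => (g (φ1 1))⁻¹ * (g ∘ φ2) t) := by
    have := hg.comp c2
    rw [e2] at this
    exact this.mul _
  have h12 : φ2 0 = φ1 1 := by ext; simp [φ1, φ2]
  have z1 : φ1 0 = 0 := by ext; simp [φ1]
  have z2 : φ2 1 = 1 := by ext; simp [φ2]
  rw [hPhi_eq hg h0, hPhi_eq d1 (by simp [z1, h0]), hPhi_eq d2 (by simp [h12])]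
  simp [z2]

lemma hPhi_proj {n N : ℕ} (h : n ≤ N) (γ : Path hawaiianBasepoint hawaiianBasepoint) : hProj n (hPhi N γ) = hPhi n γ := by
  obtain ⟨g, hg, h0⟩ := dev_path N γ
  rw [hPhi_eq hg h0, hPhi_eq (hg.proj γ.continuous h) (by simp [h0])]

/-- homomorphism to the free group -/
def hPsi (n : ℕ) : FundamentalGroup HE hawaiianBasepoint →* FreeGroup ℕ :=
  MonoidHom.mk' (fun x => Quotient.liftOn (FundamentalGroup.toPath x) (fun γ => (hPhi n γ)⁻¹)
    (fun a b h => by rw [hPhi_homotopic n h])) (by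
    intro a b
    obtain ⟨α, rfl⟩ := Path.Homotopic.Quotient.mk_surjective a
    obtain ⟨β, rfl⟩ := Path.Homotopic.Quotient.mk_surjective b
    change (hPhi n (β.trans α))⁻¹ = (hPhi n α)⁻¹ * (hPhi n β)⁻¹
    rw [hPhi_trans, mul_inv_rev])

lemma hPsi_pathClass (n : ℕ) (γ : Path hawaiianBasepoint hawaiianBasepoint) : hPsi n (pathClass γ) = (hPhi n γ)⁻¹ := rfl

lemma pathClass_surj (x : FundamentalGroup HE hawaiianBasepoint) : ∃ γ : Path hawaiianBasepoint hawaiianBasepoint, pathClass γ = x :=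
  Path.Homotopic.Quotient.mk_surjective x

lemma hPsi_proj {n N : ℕ} (h : n ≤ N) (x : FundamentalGroup HE hawaiianBasepoint) : hProj n (hPsi N x) = hPsi n x := by
  obtain ⟨γ, rfl⟩ := pathClass_surj x
  rw [hPsi_pathClass, hPsi_pathClass, map_inv, hPhi_proj h]

lemma hEta_one_hTC (p : HE) : hTC 1 (hEta 1 p) := by
  unfold hEta
  split_ifs
  · exact hTC_of _
  · exact hTC_mono hTC_one zero_le_one

lemma hEta_mem_hB {N : ℕ} (hN : 1 ≤ N) (p : HE) : hEta N p * (hEta 1 p)⁻¹ ∈ hB := by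
  by_cases h1 : p ∈ hA 1
  · have : p ∈ hA N := mem_hA.2 ⟨(mem_hA.1 h1).1, (mem_hA.1 h1).2.trans hN⟩
    simp only [hEta, h1, this]
    simp
  · rw [hEta_of_not h1, inv_one, mul_one]
    unfold hEta
    split_ifs with h
    · refine Subgroup.subset_closure ⟨_, ?_, rfl⟩
      intro hi
      exact h1 (mem_hA.2 ⟨(mem_hA.1 h.1).1, hi.le⟩)
    · exact one_mem _

lemma piece_hA {N : ℕ} (hN : 1 ≤ N) {γ : I → HE} {g : I → FreeGroup ℕ} (hg : HDev N γ g) {a b : I}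
    (hab : a ≤ b) (h : MapsTo γ (Icc a b) (hA 1)) : g a = g b :=
  const_of_eventually (isPreconnected_Icc (a := a) (b := b)) g (fun t ht =>
    (hg t).1 (mem_hA.2 ⟨(mem_hA.1 (h ht)).1, (mem_hA.1 (h ht)).2.trans hN⟩))
    (left_mem_Icc.2 hab) (right_mem_Icc.2 hab)

lemma piece_hU {N : ℕ} (hN : 1 ≤ N) {γ : I → HE} (hγ : Continuous γ) {g : I → FreeGroup ℕ}
    (hg : HDev N γ g) {a b : I}
    (hab : a ≤ b) (h : MapsTo γ (Icc a b) (hU 1)) {m : ℕ} (hm : hTC m (g a)) : hTC (m + 2) (g b) := by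
  have key := const_of_eventually (isPreconnected_Icc (a := a) (b := b))
    (fun s => (QuotientGroup.mk (g s * (hEta 1 (γ s))⁻¹) : FreeGroup ℕ ⧸ hB)) (fun t ht => by
      by_cases h' : γ t ∈ hA N
      · have h2 : ∀ᶠ s in 𝓝 t, hEta 1 (γ s) = hEta 1 (γ t) := by
          by_cases h1 : γ t ∈ hA 1
          · exact hγ.continuousAt.eventually (hEta_nhds (h ht) h1)
          · filter_upwards [hγ.continuousAt.eventually (hIdx_nhds (mem_hA.1 h').1)] with s hs
            rw [hEta_of_not h1, hEta_of_not]
            intro h3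
            exact h1 (mem_hA.2 ⟨(mem_hA.1 h').1, hs ▸ (mem_hA.1 h3).2⟩)
        filter_upwards [(hg t).1 h', h2] with s h3 h4
        rw [h3, h4]
      · filter_upwards [(hg t).2 h'] with s h3
        have h4 : γ t ∉ hA 1 := fun h4 => h' (mem_hA.2 ⟨(mem_hA.1 h4).1, (mem_hA.1 h4).2.trans hN⟩)
        rw [hEta_of_not h4, h3, eq_comm, QuotientGroup.eq]
        have := hEta_mem_hB hN (γ s)
        simpa [mul_assoc] using this)
    (left_mem_Icc.2 hab) (right_mem_Icc.2 hab)
  rw [QuotientGroup.eq] at key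
  have k := hTC_mul (hTC_mul (hTC_mul hm (hTC_inv (hEta_one_hTC (γ a)))) (hTC_hB key))
    (hEta_one_hTC (γ b))
  have e : g a * (hEta 1 (γ a))⁻¹ * ((g a * (hEta 1 (γ a))⁻¹)⁻¹ * (g b * (hEta 1 (γ b))⁻¹)) * hEta 1 (γ b)
    = g b := by group
  rw [e] at k
  exact k

lemma hPhi_bound (γ : Path hawaiianBasepoint hawaiianBasepoint) : ∃ m, ∀ᶠ β in 𝓝 γ, ∀ N ≥ 1, hTC m (hPhi N β) := by
  obtain ⟨t, t0, tm, ⟨M, hM⟩, ht⟩ := exists_monotone_Icc_subset_open_cover_unitInterval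
    (c := fun b : Bool => γ ⁻¹' (if b then hU 1 else hA 1)) (by
      rintro (_ | _)
      · exact (hA_open 1).preimage γ.continuous
      · exact (hU_open 1).preimage γ.continuous) (by
      intro s _
      by_cases h : γ s ∈ hA 1
      · exact mem_iUnion.2 ⟨false, h⟩
      · exact mem_iUnion.2 ⟨true, hA_compl_subset h⟩)
  choose i hi using ht
  refine ⟨2 * M, ?_⟩
  have hW : ∀ k, ∀ᶠ β : Path hawaiianBasepoint hawaiianBasepoint in 𝓝 γ, MapsTo β (Icc (t k) (t (k + 1))) (if i k then hU 1 else hA 1) := by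
    intro k
    have ho : IsOpen (if i k then hU 1 else hA 1) := by
      split_ifs
      · exact hU_open 1
      · exact hA_open 1
    have := (ContinuousMap.isOpen_setOfPred_mapsTo (isCompact_Icc (a := t k) (b := t (k+1))) ho).preimage
      (f := ((↑) : Path hawaiianBasepoint hawaiianBasepoint → C(I, HE))) continuous_induced_dom
    exact this.mem_nhds (hi k)
  have hW' : ∀ᶠ β : Path hawaiianBasepoint hawaiianBasepoint in 𝓝 γ, ∀ k ∈ Finset.range M,
      MapsTo β (Icc (t k) (t (k + 1))) (if i k then hU 1 else hA 1) :=
    (Finset.eventually_all _).2 fun k _ => hW k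
  filter_upwards [hW'] with β hβ N hN
  obtain ⟨g, hg, h0⟩ := dev_path N β
  rw [hPhi_eq hg h0, ← hM M le_rfl]
  have : ∀ k ≤ M, hTC (2 * k) (g (t k)) := by
    intro k
    induction k with
    | zero => intro _; rw [t0, h0]; exact hTC_one
    | succ k ih =>
      intro hk
      have := hβ k (Finset.mem_range.2 hk)
      have ih := ih (by omega)
      cases hik : i k
      · rw [hik] at this
        rw [← piece_hA hN hg (tm (Nat.le_succ k)) this]
        exact hTC_mono ih (by omega)
      · rw [hik] at this
        exact piece_hU hN β.continuous hg (tm (Nat.le_succ k)) this ih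
  exact this M le_rfl

end HawaiianHom

open Set Filter Topology unitInterval

noncomputable section HawaiianK

def tLoopFun (s : I) : HE := ⟨(Real.sin (2 * Real.pi * s), 1 - Real.cos (2 * Real.pi * s)), by
  refine mem_iUnion₂.2 ⟨1, by simp, ?_⟩
  simp only [hawaiianCircle, mem_ofPred_eq]
  push_cast
  nlinarith [Real.sin_sq_add_cos_sq (2 * Real.pi * s)]⟩

def tLoop : Path hawaiianBasepoint hawaiianBasepoint where
  toFun := tLoopFun
  continuous_toFun := by
    apply Continuous.subtype_mk
    fun_prop
  source' := by apply Subtype.ext; simp [tLoopFun, hawaiianBasepoint]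
  target' := by apply Subtype.ext; simp [tLoopFun, hawaiianBasepoint]

lemma tLoop_X (s : I) : hX (tLoop s) = Real.sin (2 * Real.pi * s) := rfl
lemma tLoop_Y (s : I) : hY (tLoop s) = 1 - Real.cos (2 * Real.pi * s) := rfl

lemma tLoop_ne {s : I} (h0 : 0 < s) (h1 : s < 1) : tLoop s ≠ hawaiianBasepoint := by
  intro h
  have h2 : 1 - Real.cos (2 * Real.pi * s) = 0 := by rw [← tLoop_Y, h, hY_base]
  have h0 : (0 : ℝ) < s := h0
  have h1 : (s : ℝ) < 1 := h1
  have h3 := (Real.cos_eq_one_iff_of_lt_of_lt (x := 2 * Real.pi * s)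
    (by nlinarith [Real.pi_pos]) (by nlinarith [Real.pi_pos])).1 (by linarith)
  have : 0 < 2 * Real.pi * s := by have := Real.pi_pos; positivity
  linarith

lemma tLoop_idx {s : I} (h0 : 0 < s) (h1 : s < 1) : hIdx (tLoop s) = 1 := by
  apply hIdx_of (tLoop_ne h0 h1)
  rw [hR, tLoop_X, tLoop_Y]
  push_cast
  nlinarith [Real.sin_sq_add_cos_sq (2 * Real.pi * s)]

open Classical in
lemma tLoop_dev {n : ℕ} (hn : 1 ≤ n) :
    HDev n tLoop (fun s => if s = 0 then 1 else FreeGroup.of 1) := by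
  intro t
  have hmem : ∀ {s : I}, 0 < s → s < 1 → tLoop s ∈ hA n := fun h0 h1 =>
    mem_hA.2 ⟨tLoop_ne h0 h1, by rw [tLoop_idx h0 h1]; exact hn⟩
  have half : (⟨1 / 2, by norm_num, by norm_num⟩ : I) ∈ Ioo (0 : I) 1 :=
    ⟨Subtype.mk_lt_mk.2 (by norm_num), Subtype.mk_lt_mk.2 (by norm_num)⟩
  refine ⟨fun h => ?_, fun h => ?_⟩
  · have : t ≠ 0 := by
      rintro rfl
      exact base_not_mem_hA n (tLoop.source ▸ h)
    filter_upwards [isOpen_ne.mem_nhds this] with s hs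
    rw [if_neg this, if_neg hs]
  · have ht : t = 0 ∨ t = 1 := by
      by_contra hc
      push Not at hc
      exact h (hmem (lt_of_le_of_ne t.2.1 (fun h => hc.1 h.symm)) (lt_of_le_of_ne t.2.2 hc.2))
    rcases ht with rfl | rfl
    · filter_upwards [gt_mem_nhds half.1] with s hs
      rw [if_pos rfl, one_mul]
      by_cases h0 : s = 0
      · rw [if_pos h0, h0, hEta_of_not h]
      · have h0' : 0 < s := lt_of_le_of_ne s.2.1 (fun h => h0 h.symm)
        have h1 : s < 1 := hs.trans half.2
        have hs' : (s : ℝ) < 1 / 2 := hs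
        have h0'' : (0 : ℝ) < s := h0'
        have hx : 0 < hX (tLoop s) := by
          rw [tLoop_X]
          have := Real.pi_pos
          apply Real.sin_pos_of_pos_of_lt_pi
          · positivity
          · nlinarith [hs']
        rw [if_neg h0, hEta, if_pos ⟨hmem h0' h1, hx⟩, tLoop_idx h0' h1]
    · filter_upwards [lt_mem_nhds half.2] with s hs
      have h0' : 0 < s := half.1.trans hs
      rw [if_neg one_ne_zero, if_neg h0'.ne']
      by_cases h1 : s = 1
      · rw [h1, hEta_of_not h, mul_one]
      · have h1' : s < 1 := lt_of_le_of_ne s.2.2 h1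
        have hs' : 1 / 2 < (s : ℝ) := hs
        have h0'' : (s : ℝ) < 1 := h1'
        rw [hEta, if_neg, mul_one]
        rintro ⟨-, hx⟩
        rw [tLoop_X] at hx
        have := Real.pi_pos
        have h3 : 0 < Real.sin (2 * Real.pi * s - Real.pi) :=
          Real.sin_pos_of_pos_of_lt_pi (by nlinarith) (by nlinarith)
        rw [Real.sin_sub_pi] at h3
        linarith

lemma hPsi_tLoop {n : ℕ} (hn : 1 ≤ n) : hPsi n (pathClass tLoop) = (FreeGroup.of 1)⁻¹ := by
  rw [hPsi_pathClass, hPhi_eq (tLoop_dev hn) (by simp)]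
  simp

def hK : Subgroup (FundamentalGroup HE hawaiianBasepoint) where
  carrier := {x | ∀ᶠ N in atTop, hAct (hPsi N x) 1 = 1}
  one_mem' := Eventually.of_forall fun N => by
    have : hPsi N 1 = 1 := map_one _
    change hAct (hPsi N 1) 1 = 1
    rw [this]; simp
  mul_mem' := by
    intro a b ha hb
    filter_upwards [ha, hb] with N h1 h2
    rw [map_mul, map_mul, Equiv.Perm.mul_apply, h2, h1]
  inv_mem' := by
    intro a ha
    filter_upwards [ha] with N h1
    rw [map_inv, map_inv, Equiv.Perm.inv_eq_iff_eq, h1]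

lemma mem_hK {x : FundamentalGroup HE hawaiianBasepoint} :
    x ∈ hK ↔ ∀ᶠ N in atTop, hAct (hPsi N x) 1 = 1 := Iff.rfl

lemma hK_open : IsOpen {γ : Path hawaiianBasepoint hawaiianBasepoint | pathClass γ ∈ hK} := by
  rw [isOpen_iff_mem_nhds]
  intro γ hγ
  obtain ⟨m, hm⟩ := hPhi_bound γ
  have key : ∀ β : Path hawaiianBasepoint hawaiianBasepoint, (∀ N ≥ 1, hTC m (hPhi N β)) →
      ∀ N ≥ m + 1, hAct (hPsi N (pathClass β)) 1 = hAct (hPsi (m + 1) (pathClass β)) 1 := by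
    intro β hβ N hN
    obtain ⟨L, hL, hc⟩ := hTC_inv (hβ N (by omega))
    rw [← hPsi_proj hN, hPsi_pathClass, ← hL, hAct_stab (m + 1) (by omega)]
    rw [hT_one]; omega
  have h1 := key γ hm.self_of_nhds
  obtain ⟨N, hN, hN'⟩ := ((mem_hK.1 hγ).and (eventually_ge_atTop (m + 1))).exists
  rw [h1 N hN'] at hN
  filter_upwards [hm, hPhi_nhds (m + 1) γ] with β hβ hβ'
  rw [mem_hK]
  filter_upwards [eventually_ge_atTop (m + 1)] with N hN2
  rw [key β hβ N hN2, hPsi_pathClass, hβ', ← hPsi_pathClass, hN]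

lemma hAct_pow_one (k : ℕ) : hAct (FreeGroup.of 1 ^ k) 1 = FreeGroup.of 1 ^ k := by
  induction k with
  | zero => simp
  | succ k ih =>
    rw [pow_succ', map_mul, Equiv.Perm.mul_apply, ih]
    have := hAct_letter 1 true (FreeGroup.of 1 ^ k)
    simpa using this

lemma hT_pow (k : ℕ) : hT (FreeGroup.of 1 ^ k) = k := by
  induction k with
  | zero => simp [hT_one]
  | succ k ih => rw [pow_succ, hT_mul, ih, hT_of]; simp

lemma core_trivial (N : Subgroup (FundamentalGroup HE hawaiianBasepoint)) (hN : N.Normal)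
    (hle : N ≤ hK) (γ : Path hawaiianBasepoint hawaiianBasepoint) (hγ : pathClass γ ∈ N)
    (n : ℕ) (hn : 1 ≤ n) : hPhi n γ = 1 := by
  obtain ⟨m, hm⟩ := hPhi_bound γ
  have hm := hm.self_of_nhds
  have h1 := mem_hK.1 (hle (hN.conj_mem _ hγ (pathClass tLoop ^ (n + m))))
  obtain ⟨M, h2, h3⟩ := (h1.and (eventually_ge_atTop n)).exists
  have hp : hPsi M (pathClass tLoop ^ (n + m)) = (FreeGroup.of 1 ^ (n + m))⁻¹ := by
    rw [map_pow, hPsi_tLoop (hn.trans h3), inv_pow]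
  have hc : hPsi M (pathClass tLoop ^ (n + m) * pathClass γ * (pathClass tLoop ^ (n + m))⁻¹) =
      (FreeGroup.of 1 ^ (n + m))⁻¹ * hPsi M (pathClass γ) * FreeGroup.of 1 ^ (n + m) := by
    rw [map_mul, map_mul, map_inv]
    change _ * _ * (hPsi M (pathClass tLoop ^ (n + m)))⁻¹ = _
    rw [hp, inv_inv]
  rw [hc, map_mul, map_mul,
    map_inv, Equiv.Perm.mul_apply, Equiv.Perm.mul_apply, hAct_pow_one, Equiv.Perm.inv_eq_iff_eq,
    hAct_pow_one] at h2
  obtain ⟨L, hL, hc⟩ := hTC_inv (hm M (hn.trans h3))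
  have h4 := hAct_core n hn L (FreeGroup.of 1 ^ (n + m)) (by rw [hT_pow]; push_cast; omega)
  rw [hL, ← hPsi_pathClass, h2, hPsi_proj h3, hPsi_pathClass] at h4
  have h5 := right_eq_mul.1 h4
  simpa using h5

end HawaiianK

open Set Filter Topology

theorem exists_limit_matching (c : ℝ → ℕ × Bool) (S : Set ℝ)
    (h : ∀ n : ℕ, 1 ≤ n → ∃ L : List ℝ, L.Pairwise (· < ·) ∧ (∀ x, x ∈ L ↔ x ∈ S ∧ (c x).1 ≤ n) ∧
      FreeGroup.mk (L.map c) = 1) :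
    ∃ M : Set (ℝ × ℝ),
      (∀ p ∈ M, p.1 ∈ S ∧ p.2 ∈ S ∧ p.1 < p.2 ∧ (c p.1).1 = (c p.2).1 ∧ (c p.1).2 ≠ (c p.2).2) ∧
      (∀ x ∈ S, ∃ p ∈ M, p.1 = x ∨ p.2 = x) ∧
      (∀ p ∈ M, ∀ p' ∈ M, p ≠ p' → HLam p p') := by
  have h' : ∀ n : ℕ, ∃ M : Set (ℝ × ℝ), 1 ≤ n →
      (∀ p ∈ M, p.1 ∈ S ∧ p.2 ∈ S ∧ p.1 < p.2 ∧ (c p.1).1 = (c p.2).1 ∧ (c p.1).2 ≠ (c p.2).2) ∧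
      (∀ x ∈ S, (c x).1 ≤ n → ∃ p ∈ M, p.1 = x ∨ p.2 = x) ∧
      (∀ p ∈ M, ∀ p' ∈ M, p ≠ p' → HLam p p') := by
    intro n
    by_cases hn : 1 ≤ n
    · obtain ⟨L, h1, h2, h3⟩ := h n hn
      obtain ⟨M, m1, m2, m3⟩ := exists_noncrossing c _ L rfl h1 h3
      refine ⟨M, fun _ => ⟨fun p hp => ?_, fun x hx hc => m2 x ((h2 x).2 ⟨hx, hc⟩), m3⟩⟩
      obtain ⟨a1, a2, a3⟩ := m1 p hp
      exact ⟨((h2 _).1 a1).1, ((h2 _).1 a2).1, a3⟩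
    · exact ⟨∅, fun h => absurd h hn⟩
  choose M hM using h'
  let u : Ultrafilter ℕ := hyperfilter ℕ
  have ev : ∀ k : ℕ, ∀ᶠ n in (u : Filter ℕ), k ≤ n := by
    intro k
    have : (u : Filter ℕ) ≤ atTop := by
      rw [← Nat.cofinite_eq_atTop]; exact hyperfilter_le_cofinite
    exact this (eventually_ge_atTop k)
  refine ⟨{p | ∀ᶠ n in (u : Filter ℕ), p ∈ M n}, fun p hp => ?_, fun x hx => ?_, fun p hp p' hp' hne => ?_⟩
  · obtain ⟨n, hn, hn1⟩ := (Eventually.and hp (ev 1)).exists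
    exact (hM n hn1).1 p hn
  · obtain ⟨L, -, h2, -⟩ := h (max 1 (c x).1) (le_max_left _ _)
    have fin : (({y | y ∈ L} : Set ℝ) ×ˢ ({y | y ∈ L} : Set ℝ)).Finite :=
      (List.finite_toSet L).prod (List.finite_toSet L)
    have key : ∀ᶠ n in (u : Filter ℕ), ∃ p ∈ (({y | y ∈ L} : Set ℝ) ×ˢ ({y | y ∈ L} : Set ℝ)),
        p ∈ M n ∧ (p.1 = x ∨ p.2 = x) := by
      filter_upwards [ev (max 1 (c x).1)] with n hn
      have hn1 : 1 ≤ n := (le_max_left _ _).trans hn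
      have hn2 : (c x).1 ≤ n := (le_max_right _ _).trans hn
      obtain ⟨p, hp, hpx⟩ := (hM n hn1).2.1 x hx hn2
      obtain ⟨a1, a2, a3, a4, a5⟩ := (hM n hn1).1 p hp
      refine ⟨p, ⟨(h2 _).2 ⟨a1, ?_⟩, (h2 _).2 ⟨a2, ?_⟩⟩, hp, hpx⟩
      · rcases hpx with rfl | rfl
        · exact le_max_right _ _
        · rw [a4]; exact le_max_right _ _
      · rcases hpx with rfl | rfl
        · rw [← a4]; exact le_max_right _ _
        · exact le_max_right _ _
    have key2 : (⋃ p ∈ (({y | y ∈ L} : Set ℝ) ×ˢ ({y | y ∈ L} : Set ℝ)),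
        {n | p ∈ M n ∧ (p.1 = x ∨ p.2 = x)}) ∈ u := by
      filter_upwards [key] with n hn
      obtain ⟨p, hp, hp2⟩ := hn
      exact mem_iUnion₂.2 ⟨p, hp, hp2⟩
    rw [Ultrafilter.finite_biUnion_mem_iff fin] at key2
    obtain ⟨p, -, hp⟩ := key2
    have hp : ∀ᶠ n in (u : Filter ℕ), p ∈ M n ∧ (p.1 = x ∨ p.2 = x) := hp
    exact ⟨p, hp.mono fun n hn => hn.1, hp.exists.choose_spec.2⟩
  · obtain ⟨n, hn, hn2, hn1⟩ := (Eventually.and hp (Eventually.and hp' (ev 1))).exists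
    exact (hM n hn1).2.2 p hn p' hn2 hne

open Set Filter Topology

noncomputable section HawaiianExc

def hTh (p : HE) : ℝ := hX p / √(hR p)

lemma hTh_sq {p : HE} (h : p ≠ hawaiianBasepoint) :
    hTh p ^ 2 = 1 - (hIdx p : ℝ) ^ 2 * hR p / 4 := by
  have h1 := hR_pos h
  have h2 := hIdx_eq p
  rw [hTh, div_pow, Real.sq_sqrt h1.le, div_eq_iff h1.ne']
  have : hX p ^ 2 = hR p - hY p ^ 2 := by simp [hR]
  rw [this]
  have h3 : hY p = hIdx p * hR p / 2 := by linarith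
  rw [h3]; ring

lemma hTh_sq_lt {p : HE} (h : p ≠ hawaiianBasepoint) : hTh p ^ 2 < 1 := by
  rw [hTh_sq h]
  have h1 := hR_pos h
  have h2 : (1 : ℝ) ≤ hIdx p := by exact_mod_cast hIdx_pos h
  have : 0 < (hIdx p : ℝ) ^ 2 * hR p := by positivity
  linarith

lemma hTh_lt {p : HE} (h : p ≠ hawaiianBasepoint) : -1 < hTh p ∧ hTh p < 1 := by
  have := hTh_sq_lt h
  exact abs_lt.1 ((sq_lt_one_iff_abs_lt_one _).1 this)

lemma hTh_contAt {p : HE} (h : p ≠ hawaiianBasepoint) : ContinuousAt hTh p :=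
  hX_cont.continuousAt.div (Real.continuous_sqrt.comp hR_cont).continuousAt
    (Real.sqrt_pos.2 (hR_pos h)).ne'

lemma he_eq_of {p q : HE} (hp : p ≠ hawaiianBasepoint) (hq : q ≠ hawaiianBasepoint)
    (hi : hIdx p = hIdx q) (ht : hTh p = hTh q) : p = q := by
  have h1 := hTh_sq hp
  have h2 := hTh_sq hq
  have hi1 : (1 : ℝ) ≤ hIdx q := by exact_mod_cast hIdx_pos hq
  rw [ht, h2, hi] at h1
  have hR' : hR p = hR q := by
    have h3 : (hIdx q : ℝ) ^ 2 * (hR p - hR q) = 0 := by linarith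
    rcases mul_eq_zero.1 h3 with h | h
    · have : (0 : ℝ) < (hIdx q : ℝ) ^ 2 := by positivity
      linarith
    · linarith
  apply he_ext
  · unfold hTh at ht
    rw [hR'] at ht
    exact (div_left_inj' (Real.sqrt_pos.2 (hR_pos hq)).ne').1 ht
  · have e1 := hIdx_eq p
    have e2 := hIdx_eq q
    rw [hi, hR', e2] at e1
    linarith

lemma hX_ne_of_small {p : HE} (h : p ≠ hawaiianBasepoint) (hs : (hIdx p : ℝ) ^ 2 * hR p < 4) :
    hX p ≠ 0 := by
  intro hx
  have := hTh_sq h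
  rw [hTh, hx] at this
  norm_num at this
  linarith

lemma hTh_eq_sqrt {p : HE} (h : p ≠ hawaiianBasepoint) (hx : 0 < hX p) :
    hTh p = √(1 - (hIdx p : ℝ) ^ 2 * hR p / 4) := by
  rw [← hTh_sq h, Real.sqrt_sq]
  exact div_nonneg hx.le (Real.sqrt_nonneg _)

lemma hTh_eq_neg_sqrt {p : HE} (h : p ≠ hawaiianBasepoint) (hx : hX p < 0) :
    hTh p = -√(1 - (hIdx p : ℝ) ^ 2 * hR p / 4) := by
  rw [← hTh_sq h, Real.sqrt_sq_eq_abs, abs_of_nonpos, neg_neg]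
  exact div_nonpos_of_nonpos_of_nonneg hx.le (Real.sqrt_nonneg _)

/-- excursion of `f` away from the base point -/
structure Exc (f : ℝ → HE) (a b : ℝ) : Prop where
  lt : a < b
  left : f a = hawaiianBasepoint
  right : f b = hawaiianBasepoint
  ne : ∀ s ∈ Ioo a b, f s ≠ hawaiianBasepoint

variable {f : ℝ → HE}

lemma Exc.le_of_lt {a b a' b' : ℝ} (h : Exc f a b) (h' : Exc f a' b') (hlt : a < a') : b ≤ a' := by
  by_contra hc
  push Not at hc
  exact h.ne a' ⟨hlt, hc⟩ h'.left

lemma Exc.unique {a b b' : ℝ} (h : Exc f a b) (h' : Exc f a b') : b = b' := by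
  by_contra hne
  rcases lt_or_gt_of_ne hne with hlt | hlt
  · exact h'.ne b ⟨h.lt, hlt⟩ h.right
  · exact h.ne b' ⟨h'.lt, hlt⟩ h'.right

lemma exc_exists (hf : Continuous f) (h0 : ∀ s ≤ 0, f s = hawaiianBasepoint)
    (h1 : ∀ s, 1 ≤ s → f s = hawaiianBasepoint) {s : ℝ} (hs : f s ≠ hawaiianBasepoint) :
    ∃ a b, Exc f a b ∧ s ∈ Ioo a b := by
  have cl : IsClosed {t | f t = hawaiianBasepoint} := isClosed_eq hf continuous_const
  have s0 : 0 < s := by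
    by_contra hc; exact hs (h0 s (not_lt.1 hc))
  have s1 : s < 1 := by
    by_contra hc; exact hs (h1 s (not_lt.1 hc))
  have A := (cl.inter (isClosed_Iic (a := s))).csSup_mem ⟨0, h0 0 le_rfl, s0.le⟩ ⟨s, fun x hx => hx.2⟩
  have B := (cl.inter (isClosed_Ici (a := s))).csInf_mem ⟨1, h1 1 le_rfl, s1.le⟩ ⟨s, fun x hx => hx.2⟩
  set a := sSup ({t | f t = hawaiianBasepoint} ∩ Iic s)
  set b := sInf ({t | f t = hawaiianBasepoint} ∩ Ici s)
  have as : a < s := lt_of_le_of_ne A.2 (fun h => hs (h ▸ A.1))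
  have sb : s < b := lt_of_le_of_ne B.2 (fun h => hs (h ▸ B.1))
  refine ⟨a, b, ⟨as.trans sb, A.1, B.1, fun t ht hft => ?_⟩, as, sb⟩
  rcases le_total t s with h | h
  · have : t ≤ a := le_csSup ⟨s, fun x hx => hx.2⟩ ⟨hft, h⟩
    exact absurd ht.1 (not_lt.2 this)
  · have : b ≤ t := csInf_le ⟨s, fun x hx => hx.2⟩ ⟨hft, h⟩
    exact absurd ht.2 (not_lt.2 this)

lemma Exc.nonneg {a b : ℝ} (h : Exc f a b) (h0 : ∀ s ≤ 0, f s = hawaiianBasepoint) : 0 ≤ a := by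
  by_contra hc
  push Not at hc
  have hm : a < min 0 b := lt_min hc h.lt
  obtain ⟨t, ht1, ht2⟩ := exists_between hm
  exact h.ne t ⟨ht1, ht2.trans_le (min_le_right _ _)⟩ (h0 t (ht2.le.trans (min_le_left _ _)))

lemma Exc.le_one {a b : ℝ} (h : Exc f a b) (h1 : ∀ s, 1 ≤ s → f s = hawaiianBasepoint) : b ≤ 1 := by
  by_contra hc
  push Not at hc
  have hm : max 1 a < b := max_lt hc h.lt
  obtain ⟨t, ht1, ht2⟩ := exists_between hm
  exact h.ne t ⟨(le_max_right _ _).trans_lt ht1, ht2⟩ (h1 t ((le_max_left _ _).trans ht1.le))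

lemma Exc.idx {a b : ℝ} (h : Exc f a b) (hf : Continuous f) {s t : ℝ} (hs : s ∈ Ioo a b)
    (ht : t ∈ Ioo a b) : hIdx (f s) = hIdx (f t) :=
  const_of_eventually isPreconnected_Ioo (fun s => hIdx (f s))
    (fun r hr => hf.continuousAt.eventually (hIdx_nhds (h.ne r hr))) hs ht

def excIdx (f : ℝ → HE) (a : ℝ) : ℕ := sSup {i | ∃ᶠ s in 𝓝[>] a, hIdx (f s) = i}

lemma Exc.idx_eq {a b : ℝ} (h : Exc f a b) (hf : Continuous f) {s : ℝ} (hs : s ∈ Ioo a b) :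
    hIdx (f s) = excIdx f a := by
  have ev : ∀ᶠ t in 𝓝[>] a, hIdx (f t) = hIdx (f s) := by
    filter_upwards [Ioo_mem_nhdsGT h.lt] with t ht
    exact h.idx hf ht hs
  have : {i | ∃ᶠ s in 𝓝[>] a, hIdx (f s) = i} = {hIdx (f s)} := by
    ext i
    simp only [mem_ofPred_eq, mem_singleton_iff]
    constructor
    · intro hi
      obtain ⟨t, h1, h2⟩ := (hi.and_eventually ev).exists
      rw [← h1, h2]
    · rintro rfl
      exact ev.frequently
  rw [excIdx, this, csSup_singleton]

/-- sign constancy -/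
lemma sign_const (hf : Continuous f) {S : Set ℝ} (hS : IsPreconnected S)
    (h : ∀ s ∈ S, hX (f s) ≠ 0) : (∀ s ∈ S, 0 < hX (f s)) ∨ (∀ s ∈ S, hX (f s) < 0) := by
  by_contra hc
  push Not at hc
  obtain ⟨⟨s, hs, hs'⟩, t, ht, ht'⟩ := hc
  have := hS.intermediate_value hs ht (f := fun s => hX (f s)) (hX_cont.comp hf).continuousOn
  obtain ⟨r, hr, hr'⟩ := this ⟨hs', ht'⟩
  exact h r hr hr'

lemma Exc.small {a b : ℝ} (hf : Continuous f) (i : ℕ) {c : ℝ}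
    (hc : f c = hawaiianBasepoint) : ∀ᶠ s in 𝓝 c, (i : ℝ) ^ 2 * hR (f s) < 4 := by
  have : ContinuousAt (fun s => (i : ℝ) ^ 2 * hR (f s)) c :=
    (continuous_const.mul (hR_cont.comp hf)).continuousAt
  exact this.eventually (gt_mem_nhds (by simp [hc, hR_base]))

def startPos (f : ℝ → HE) (a : ℝ) : Prop := ∀ᶠ s in 𝓝[>] a, 0 < hX (f s)
def endPos (f : ℝ → HE) (b : ℝ) : Prop := ∀ᶠ s in 𝓝[<] b, 0 < hX (f s)

lemma Exc.startNeg {a b : ℝ} (h : Exc f a b) (hf : Continuous f) (hn : ¬ startPos f a) :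
    ∀ᶠ s in 𝓝[>] a, hX (f s) < 0 := by
  have e1 := Exc.small (a := a) (b := b) hf (excIdx f a) h.left
  have e2 : ∀ᶠ s in 𝓝[>] a, (excIdx f a : ℝ) ^ 2 * hR (f s) < 4 := nhdsWithin_le_nhds e1
  obtain ⟨u, hu, hu2⟩ := (mem_nhdsGT_iff_exists_Ioo_subset).1 e2
  have hu : a < u := hu
  have hm : a < min u b := lt_min hu h.lt
  rcases sign_const hf (isPreconnected_Ioo (a := a) (b := min u b)) (fun s hs => by
    have hs1 : s ∈ Ioo a b := ⟨hs.1, hs.2.trans_le (min_le_right _ _)⟩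
    apply hX_ne_of_small (h.ne s hs1)
    rw [h.idx_eq hf hs1]
    exact hu2 ⟨hs.1, hs.2.trans_le (min_le_left _ _)⟩) with hp | hp
  · exact absurd (mem_of_superset (Ioo_mem_nhdsGT hm) hp) hn
  · exact mem_of_superset (Ioo_mem_nhdsGT hm) hp

lemma Exc.endNeg {a b : ℝ} (h : Exc f a b) (hf : Continuous f) (hn : ¬ endPos f b) :
    ∀ᶠ s in 𝓝[<] b, hX (f s) < 0 := by
  have e1 := Exc.small (a := a) (b := b) hf (excIdx f a) h.right
  have e2 : ∀ᶠ s in 𝓝[<] b, (excIdx f a : ℝ) ^ 2 * hR (f s) < 4 := nhdsWithin_le_nhds e1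
  obtain ⟨u, hu, hu2⟩ := (mem_nhdsLT_iff_exists_Ioo_subset).1 e2
  have hu : u < b := hu
  have hm : max u a < b := max_lt hu h.lt
  rcases sign_const hf (isPreconnected_Ioo (a := max u a) (b := b)) (fun s hs => by
    have hs1 : s ∈ Ioo a b := ⟨(le_max_right _ _).trans_lt hs.1, hs.2⟩
    apply hX_ne_of_small (h.ne s hs1)
    rw [h.idx_eq hf hs1]
    exact hu2 ⟨(le_max_left _ _).trans_lt hs.1, hs.2⟩) with hp | hp
  · exact absurd (mem_of_superset (Ioo_mem_nhdsLT hm) hp) hn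
  · exact mem_of_superset (Ioo_mem_nhdsLT hm) hp

lemma th_tendsto (hf : Continuous f) {c : ℝ} (hc : f c = hawaiianBasepoint) (i : ℕ) {l : Filter ℝ}
    (hl : l ≤ 𝓝 c) (hne : ∀ᶠ s in l, f s ≠ hawaiianBasepoint ∧ hIdx (f s) = i) :
    ((∀ᶠ s in l, 0 < hX (f s)) → Tendsto (fun s => hTh (f s)) l (𝓝 1)) ∧
    ((∀ᶠ s in l, hX (f s) < 0) → Tendsto (fun s => hTh (f s)) l (𝓝 (-1))) := by
  have hT : Tendsto (fun s => √(1 - (i : ℝ) ^ 2 * hR (f s) / 4)) l (𝓝 1) := by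
    have hcont : Continuous (fun s => √(1 - (i : ℝ) ^ 2 * hR (f s) / 4)) := by
      have := hR_cont.comp hf
      simp only [Function.comp_def] at this
      fun_prop
    have := hcont.tendsto c
    simp only [hc, hR_base] at this
    simp at this
    exact this.mono_left hl
  constructor
  · intro h
    refine hT.congr' ?_
    filter_upwards [h, hne] with s h1 h2
    rw [hTh_eq_sqrt h2.1 h1, h2.2]
  · intro h
    refine hT.neg.congr' ?_
    filter_upwards [h, hne] with s h1 h2
    rw [hTh_eq_neg_sqrt h2.1 h1, h2.2]

open Classical in
def sgn (P : Prop) : ℝ := if P then 1 else -1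

lemma Exc.th_start {a b : ℝ} (h : Exc f a b) (hf : Continuous f) :
    Tendsto (fun s => hTh (f s)) (𝓝[>] a) (𝓝 (sgn (startPos f a))) := by
  have := th_tendsto hf h.left (excIdx f a) (l := 𝓝[>] a) nhdsWithin_le_nhds (by
    filter_upwards [Ioo_mem_nhdsGT h.lt] with s hs using ⟨h.ne s hs, h.idx_eq hf hs⟩)
  by_cases hp : startPos f a
  · simpa [sgn, hp] using this.1 hp
  · simpa [sgn, hp] using this.2 (h.startNeg hf hp)

lemma Exc.th_end {a b : ℝ} (h : Exc f a b) (hf : Continuous f) :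
    Tendsto (fun s => hTh (f s)) (𝓝[<] b) (𝓝 (sgn (endPos f b))) := by
  have := th_tendsto hf h.right (excIdx f a) (l := 𝓝[<] b) nhdsWithin_le_nhds (by
    filter_upwards [Ioo_mem_nhdsLT h.lt] with s hs using ⟨h.ne s hs, h.idx_eq hf hs⟩)
  by_cases hp : endPos f b
  · simpa [sgn, hp] using this.1 hp
  · simpa [sgn, hp] using this.2 (h.endNeg hf hp)

end HawaiianExc

open Set Filter Topology unitInterval

noncomputable section HawaiianWord

variable {f : ℝ → HE}

def rb (f : ℝ → HE) (a : ℝ) : ℝ := sInf {b | Exc f a b}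

lemma Exc.rb_eq {a b : ℝ} (h : Exc f a b) : rb f a = b := by
  have : {b | Exc f a b} = {b} := by
    ext c
    exact ⟨fun hc => Exc.unique hc h, fun hc => by rw [mem_singleton_iff.1 hc]; exact h⟩
  rw [rb, this, csInf_singleton]

def ess (f : ℝ → HE) (a : ℝ) : Prop := (∃ b, Exc f a b) ∧ ¬(startPos f a ↔ endPos f (rb f a))

open Classical in
def letter (f : ℝ → HE) (a : ℝ) : ℕ × Bool := (excIdx f a, decide (startPos f a))

open Classical in
lemma exc_step {n : ℕ} {G : ℝ → FreeGroup ℕ} (hf : Continuous f) (hG : HDev n f G) {a b : ℝ}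
    (h : Exc f a b) (hi : excIdx f a ≤ n) :
    G b = G a * (if startPos f a then FreeGroup.of (excIdx f a) else 1) *
      (if endPos f b then FreeGroup.of (excIdx f a) else 1)⁻¹ := by
  have mem : ∀ s ∈ Ioo a b, f s ∈ hA n := fun s hs =>
    mem_hA.2 ⟨h.ne s hs, by rw [h.idx_eq hf hs]; exact hi⟩
  have cst : ∀ s ∈ Ioo a b, ∀ t ∈ Ioo a b, G s = G t := fun s hs t ht =>
    const_of_eventually isPreconnected_Ioo G (fun r hr => (hG r).1 (mem r hr)) hs ht
  obtain ⟨s, hs, hs1⟩ : ∃ s ∈ Ioo a b,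
      G s = G a * (if startPos f a then FreeGroup.of (excIdx f a) else 1) := by
    have e1 : ∀ᶠ s in 𝓝[>] a, G s = G a * hEta n (f s) :=
      nhdsWithin_le_nhds ((hG a).2 (by rw [h.left]; exact base_not_mem_hA n))
    by_cases hp : startPos f a
    · obtain ⟨s, h1, h2, h3⟩ := (Eventually.and (p := fun s => s ∈ Ioo a b) (Ioo_mem_nhdsGT h.lt)
        (e1.and hp)).exists
      refine ⟨s, h1, ?_⟩
      rw [h2, if_pos hp, hEta, if_pos ⟨mem s h1, h3⟩, h.idx_eq hf h1]
    · obtain ⟨s, h1, h2, h3⟩ := (Eventually.and (p := fun s => s ∈ Ioo a b) (Ioo_mem_nhdsGT h.lt)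
        (e1.and (h.startNeg hf hp))).exists
      refine ⟨s, h1, ?_⟩
      rw [h2, if_neg hp, hEta, if_neg (fun hc => lt_asymm hc.2 h3)]
  obtain ⟨t, ht, ht1⟩ : ∃ s ∈ Ioo a b,
      G s = G b * (if endPos f b then FreeGroup.of (excIdx f a) else 1) := by
    have e1 : ∀ᶠ s in 𝓝[<] b, G s = G b * hEta n (f s) :=
      nhdsWithin_le_nhds ((hG b).2 (by rw [h.right]; exact base_not_mem_hA n))
    by_cases hp : endPos f b
    · obtain ⟨s, h1, h2, h3⟩ := (Eventually.and (p := fun s => s ∈ Ioo a b) (Ioo_mem_nhdsLT h.lt)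
        (e1.and hp)).exists
      refine ⟨s, h1, ?_⟩
      rw [h2, if_pos hp, hEta, if_pos ⟨mem s h1, h3⟩, h.idx_eq hf h1]
    · obtain ⟨s, h1, h2, h3⟩ := (Eventually.and (p := fun s => s ∈ Ioo a b) (Ioo_mem_nhdsLT h.lt)
        (e1.and (h.endNeg hf hp))).exists
      refine ⟨s, h1, ?_⟩
      rw [h2, if_neg hp, hEta, if_neg (fun hc => lt_asymm hc.2 h3)]
  rw [← hs1, cst s hs t ht, ht1, mul_inv_cancel_right]

lemma hU_step {n : ℕ} {G : ℝ → FreeGroup ℕ} (hf : Continuous f) (hG : HDev n f G) {x y : ℝ}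
    (hxy : x ≤ y) (hx : f x = hawaiianBasepoint) (hy : f y = hawaiianBasepoint)
    (h : ∀ s ∈ Icc x y, f s ∈ hU n) : G x = G y := by
  have := const_of_eventually isPreconnected_Icc (fun s => G s * (hEta n (f s))⁻¹)
    (fun r hr => hG.hU hf (h r hr)) (left_mem_Icc.2 hxy) (right_mem_Icc.2 hxy)
  simpa [hx, hy, hEta_of_not (base_not_mem_hA n)] using this

lemma ess_top {a b : ℝ} (hf : Continuous f) (h : Exc f a b) (he : ess f a) :
    ∃ s ∈ Ioo a b, hX (f s) = 0 := by
  by_contra hc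
  push Not at hc
  apply he.2
  rw [h.rb_eq]
  rcases sign_const hf isPreconnected_Ioo hc with hp | hp
  · exact ⟨fun _ => mem_of_superset (Ioo_mem_nhdsLT h.lt) hp,
      fun _ => mem_of_superset (Ioo_mem_nhdsGT h.lt) hp⟩
  · constructor
    · intro hs
      obtain ⟨s, h1, h2⟩ := (hs.and (Ioo_mem_nhdsGT h.lt)).exists
      exact absurd h1 (lt_asymm (hp s h2))
    · intro hs
      obtain ⟨s, h1, h2⟩ := (Eventually.and hs (Ioo_mem_nhdsLT h.lt)).exists
      exact absurd h1 (lt_asymm (hp s h2))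

theorem exc_word (hf : Continuous f) (h0 : ∀ s ≤ 0, f s = hawaiianBasepoint)
    (h1 : ∀ s, 1 ≤ s → f s = hawaiianBasepoint) {n : ℕ} {G : ℝ → FreeGroup ℕ} (hG : HDev n f G)
    (hG0 : G 0 = 1) (x : ℝ) (hx0 : 0 ≤ x) (hx : f x = hawaiianBasepoint) :
    ∃ L : List ℝ, L.Pairwise (· < ·) ∧ (∀ y, y ∈ L ↔ (ess f y ∧ excIdx f y ≤ n) ∧ y < x) ∧
      G x = FreeGroup.mk (L.map (letter f)) := by
  classical
  -- bad points
  have bad : ∀ s, f s ∉ hU n → ∃ a b, Exc f a b ∧ s ∈ Ioo a b ∧ excIdx f a ≤ n := by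
    intro s hs
    have hsA : f s ∈ hA n := by
      by_contra hc; exact hs (hA_compl_subset hc)
    obtain ⟨a, b, h, hab⟩ := exc_exists hf h0 h1 (mem_hA.1 hsA).1
    exact ⟨a, b, h, hab, by rw [← h.idx_eq hf hab]; exact (mem_hA.1 hsA).2⟩
  let E : Set ℝ := {a | ∃ b, Exc f a b ∧ ∃ s ∈ Ioo a b, f s ∉ hU n}
  have hEfin : E.Finite := by
    have hK : IsCompact {s | s ∈ Icc (0 : ℝ) 1 ∧ f s ∉ hU n} := by
      have : {s | s ∈ Icc (0 : ℝ) 1 ∧ f s ∉ hU n} = Icc (0 : ℝ) 1 ∩ (f ⁻¹' (hU n))ᶜ := rfl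
      rw [this]
      exact isCompact_Icc.inter_right ((hU_open n).preimage hf).isClosed_compl
    obtain ⟨t, ht⟩ := hK.elim_finite_subcover (fun p : {p : ℝ × ℝ // Exc f p.1 p.2} => Ioo p.1.1 p.1.2)
      (fun _ => isOpen_Ioo) (by
        rintro s ⟨-, hs⟩
        obtain ⟨a, b, h, hab, -⟩ := bad s hs
        exact mem_iUnion.2 ⟨⟨(a, b), h⟩, hab⟩)
    refine ((t.image fun p => p.1.1).finite_toSet).subset ?_
    rintro a ⟨b, h, s, hs, hsU⟩
    have hs01 : s ∈ Icc (0 : ℝ) 1 :=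
      ⟨(h.nonneg h0).trans hs.1.le, hs.2.le.trans (h.le_one h1)⟩
    obtain ⟨p, hp, hps⟩ := mem_iUnion₂.1 (ht ⟨hs01, hsU⟩)
    have : a = p.1.1 := by
      by_contra hne
      rcases lt_or_gt_of_ne hne with hlt | hlt
      · have := h.le_of_lt p.2 hlt
        linarith [hs.2, hps.1]
      · have := p.2.le_of_lt h hlt
        linarith [hs.1, hps.2]
    simp only [Finset.coe_image, mem_image]
    exact ⟨p, hp, this.symm⟩
  have essE : ∀ y, ess f y → excIdx f y ≤ n → y ∈ E := by
    intro y hy hi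
    obtain ⟨b, h⟩ := hy.1
    obtain ⟨s, hs, hsx⟩ := ess_top hf h hy
    refine ⟨b, h, s, hs, fun hU => ?_⟩
    exact hU_inter_hA hU (mem_hA.2 ⟨h.ne s hs, by rw [h.idx_eq hf hs]; exact hi⟩) hsx
  obtain ⟨k, hk⟩ : ∃ k, ({a ∈ hEfin.toFinset | a < x}).card = k := ⟨_, rfl⟩
  induction k using Nat.strong_induction_on generalizing x with
  | _ k ih =>
  rcases ({a ∈ hEfin.toFinset | a < x}).eq_empty_or_nonempty with hem | hne
  · have noE : ∀ a ∈ E, ¬ a < x := by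
      intro a ha hlt
      have : a ∈ ({a ∈ hEfin.toFinset | a < x}) := by simp [ha, hlt]
      rw [hem] at this
      simp at this
    refine ⟨[], List.Pairwise.nil, ?_, ?_⟩
    · intro y
      constructor
      · intro h; simp at h
      · rintro ⟨⟨h2, h3⟩, h4⟩
        exact absurd h4 (noE y (essE y h2 h3))
    · rw [← hU_step hf hG hx0 (h0 0 le_rfl) hx, hG0]
      · simp [FreeGroup.one_eq_mk]
      · intro s hs
        by_contra hsU
        obtain ⟨a, b, h, hab, -⟩ := bad s hsU
        exact noE a ⟨b, h, s, hab, hsU⟩ (hab.1.trans_le hs.2)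
  · obtain ⟨a, ha, hmax⟩ := Finset.exists_max_image _ id hne
    simp only [Finset.mem_filter, Finite.mem_toFinset, id] at ha hmax
    obtain ⟨⟨b, h, s0, hs0, hs0U⟩, hax⟩ := ha
    have hbx : b ≤ x := by
      by_contra hc
      push Not at hc
      exact h.ne x ⟨hax, hc⟩ hx
    have hia : excIdx f a ≤ n := by
      have hsA : f s0 ∈ hA n := by
        by_contra hc; exact hs0U (hA_compl_subset hc)
      rw [← h.idx_eq hf hs0]; exact (mem_hA.1 hsA).2
    have hlt : ({c ∈ hEfin.toFinset | c < a}).card < k := by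
      rw [← hk]
      apply Finset.card_lt_card
      refine ⟨fun c hc => ?_, fun hsub => ?_⟩
      · simp only [Finset.mem_filter] at hc ⊢
        exact ⟨hc.1, hc.2.trans hax⟩
      · have : a ∈ ({c ∈ hEfin.toFinset | c < x}) := by
          simp only [Finset.mem_filter, Finite.mem_toFinset]
          exact ⟨⟨b, h, s0, hs0, hs0U⟩, hax⟩
        have := hsub this
        simp at this
    obtain ⟨L, hL1, hL2, hL3⟩ := ih _ hlt a (h.nonneg h0) h.left rfl
    have hGx : G b = G x := by
      apply hU_step hf hG hbx h.right hx
      intro s hs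
      by_contra hsU
      obtain ⟨a', b', h', hab', -⟩ := bad s hsU
      have hle := hmax a' ⟨⟨b', h', s, hab', hsU⟩, hab'.1.trans_le hs.2⟩
      rcases hle.lt_or_eq with hl | hl
      · have := h'.le_of_lt h hl
        linarith [hab'.2, hs.1, h.lt]
      · subst hl
        have := h'.unique h
        linarith [hab'.2, hs.1]
    have hstep := exc_step hf hG h hia
    rw [hGx, hL3] at hstep
    have hbetween : ∀ y, ess f y → excIdx f y ≤ n → y < x → y ≤ a := fun y h2 h3 h4 =>
      hmax y ⟨essE y h2 h3, h4⟩
    by_cases he : ess f a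
    · refine ⟨L ++ [a], ?_, ?_, ?_⟩
      · rw [List.pairwise_append]
        refine ⟨hL1, List.pairwise_singleton _ _, fun y hy z hz => ?_⟩
        rw [List.mem_singleton.1 hz]
        exact ((hL2 y).1 hy).2
      · intro y
        rw [List.mem_append, List.mem_singleton, hL2]
        constructor
        · rintro (⟨h2, h3⟩ | rfl)
          · exact ⟨h2, h3.trans hax⟩
          · exact ⟨⟨he, hia⟩, hax⟩
        · rintro ⟨h2, h3⟩
          rcases (hbetween y h2.1 h2.2 h3).lt_or_eq with h4 | h4
          · exact Or.inl ⟨h2, h4⟩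
          · exact Or.inr h4
      · rw [hstep, List.map_append, ← FreeGroup.mul_mk, mul_assoc]
        congr 1
        have hne := he.2
        rw [h.rb_eq] at hne
        rw [List.map_singleton, letter, mk_cons_eq]
        by_cases hs : startPos f a
        · have hee : ¬ endPos f b := fun h => hne ⟨fun _ => h, fun _ => hs⟩
          simp [hs, hee, ← FreeGroup.one_eq_mk]
        · have hee : endPos f b := by
            by_contra hc
            exact hne ⟨fun h => absurd h hs, fun h => absurd h hc⟩
          simp [hs, hee, ← FreeGroup.one_eq_mk]
    · refine ⟨L, hL1, ?_, ?_⟩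
      · intro y
        rw [hL2]
        constructor
        · rintro ⟨h2, h3⟩
          exact ⟨h2, h3.trans hax⟩
        · rintro ⟨h2, h3⟩
          refine ⟨h2, lt_of_le_of_ne (hbetween y h2.1 h2.2 h3) ?_⟩
          rintro rfl
          exact he h2.1
      · rw [hstep]
        have : startPos f a ↔ endPos f b := by
          by_contra hc
          exact he ⟨⟨b, h⟩, by rwa [h.rb_eq]⟩
        rw [mul_assoc]
        by_cases hs : startPos f a
        · simp [hs, this.1 hs]
        · simp [hs, mt this.2 hs]

end HawaiianWord

open Set Filter Topology unitInterval

noncomputable section HawaiianFinal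

variable {f : ℝ → HE}

open Classical in
def vEnd (f : ℝ → HE) (a : ℝ) : ℝ := if startPos f a ↔ endPos f (rb f a) then 0 else 1

open Classical in
def vf (f : ℝ → HE) (a s : ℝ) : ℝ :=
  if s ≤ a then 0 else if s < rb f a then (1 - sgn (startPos f a) * hTh (f s)) / 2 else vEnd f a

lemma vf_le {a s : ℝ} (h : s ≤ a) : vf f a s = 0 := by simp [vf, h]

lemma vf_mid {a b s : ℝ} (h : Exc f a b) (hs : s ∈ Ioo a b) :
    vf f a s = (1 - sgn (startPos f a) * hTh (f s)) / 2 := by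
  simp [vf, h.rb_eq, hs.2, not_le.2 hs.1]

lemma vf_ge {a b s : ℝ} (h : Exc f a b) (hs : b ≤ s) : vf f a s = vEnd f a := by
  simp [vf, h.rb_eq, not_lt.2 hs, not_le.2 (h.lt.trans_le hs)]

lemma sgn_cases (P : Prop) : (P ∧ sgn P = 1) ∨ (¬ P ∧ sgn P = -1) := by
  by_cases h : P
  · left; simp [sgn, h]
  · right; simp [sgn, h]

lemma vEnd_ess {a : ℝ} (h : ess f a) : vEnd f a = 1 := by simp [vEnd, h.2]

lemma vEnd_iness {a b : ℝ} (h : Exc f a b) (h' : ¬ ess f a) : vEnd f a = 0 := by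
  have : startPos f a ↔ endPos f (rb f a) := by
    by_contra hc; exact h' ⟨⟨b, h⟩, hc⟩
  simp [vEnd, this]

lemma vEnd_eq {a b : ℝ} (h : Exc f a b) :
    vEnd f a = (1 - sgn (startPos f a) * sgn (endPos f b)) / 2 := by
  rw [vEnd, h.rb_eq]
  rcases sgn_cases (startPos f a) with ⟨h1, h2⟩ | ⟨h1, h2⟩ <;>
  rcases sgn_cases (endPos f b) with ⟨h3, h4⟩ | ⟨h3, h4⟩ <;>
  rw [h2, h4] <;> simp [h1, h3] <;> norm_num

lemma vf_mid_bd {a b s : ℝ} (h : Exc f a b) (hs : s ∈ Ioo a b) : 0 < vf f a s ∧ vf f a s < 1 := by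
  rw [vf_mid h hs]
  have := hTh_lt (h.ne s hs)
  rcases sgn_cases (startPos f a) with ⟨h1, h2⟩ | ⟨h1, h2⟩ <;> rw [h2] <;> constructor <;> linarith

lemma vf_cont (hf : Continuous f) {a b : ℝ} (h : Exc f a b) : Continuous (vf f a) := by
  rw [continuous_iff_continuousAt]
  intro s
  rcases lt_trichotomy s a with hs | rfl | hs
  · have : vf f a =ᶠ[𝓝 s] fun _ => 0 := by
      filter_upwards [gt_mem_nhds hs] with t ht using vf_le (le_of_lt ht)
    exact continuousAt_const.congr this.symm
  · rw [continuousAt_iff_continuous_left'_right']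
    constructor
    · rw [ContinuousWithinAt, vf_le le_rfl]
      refine tendsto_const_nhds.congr' ?_
      filter_upwards [self_mem_nhdsWithin] with t ht using (vf_le (le_of_lt ht)).symm
    · rw [ContinuousWithinAt, vf_le le_rfl]
      have h1 := ((tendsto_const_nhds (x := (1 : ℝ))).sub
        ((h.th_start hf).const_mul (sgn (startPos f s)))).div_const 2
      have e : (1 - sgn (startPos f s) * sgn (startPos f s)) / 2 = 0 := by
        rcases sgn_cases (startPos f s) with ⟨_, h2⟩ | ⟨_, h2⟩ <;> rw [h2] <;> norm_num
      rw [e] at h1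
      refine h1.congr' ?_
      filter_upwards [Ioo_mem_nhdsGT h.lt] with t ht using (vf_mid h ht).symm
  · rcases lt_trichotomy s b with hs' | rfl | hs'
    · have : vf f a =ᶠ[𝓝 s] fun t => (1 - sgn (startPos f a) * hTh (f t)) / 2 := by
        filter_upwards [Ioo_mem_nhds hs hs'] with t ht using vf_mid h ht
      have hc : ContinuousAt (fun t => hTh (f t)) s :=
        (hTh_contAt (h.ne s ⟨hs, hs'⟩)).comp hf.continuousAt
      exact ((continuousAt_const.sub (continuousAt_const.mul hc)).div_const 2).congr this.symm
    · rw [continuousAt_iff_continuous_left'_right']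
      constructor
      · rw [ContinuousWithinAt, vf_ge h le_rfl, vEnd_eq h]
        have h1 := ((tendsto_const_nhds (x := (1 : ℝ))).sub
          ((h.th_end hf).const_mul (sgn (startPos f a)))).div_const 2
        refine h1.congr' ?_
        filter_upwards [Ioo_mem_nhdsLT h.lt] with t ht using (vf_mid h ht).symm
      · rw [ContinuousWithinAt, vf_ge h le_rfl]
        refine tendsto_const_nhds.congr' ?_
        filter_upwards [self_mem_nhdsWithin] with t ht using (vf_ge h (le_of_lt ht)).symm
    · have : vf f a =ᶠ[𝓝 s] fun _ => vEnd f a := by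
        filter_upwards [lt_mem_nhds hs'] with t ht using vf_ge h (le_of_lt ht)
      exact continuousAt_const.congr this.symm

open Classical in
def uf (f : ℝ → HE) (q : ℝ × ℝ) (s : ℝ) : ℝ := if q.1 = q.2 then vf f q.1 s else vf f q.1 s - vf f q.2 s

/-- admissible pairs -/
def Adm (f : ℝ → HE) (q : ℝ × ℝ) : Prop :=
  (q.1 = q.2 ∧ (∃ b, Exc f q.1 b) ∧ ¬ ess f q.1) ∨
  (q.1 < q.2 ∧ ess f q.1 ∧ ess f q.2 ∧ excIdx f q.1 = excIdx f q.2 ∧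
    ¬ (startPos f q.1 ↔ startPos f q.2))

/-- trichotomy for the values of `uf` -/
lemma uf_cases (hf : Continuous f) {q : ℝ × ℝ} (hq : Adm f q) {b d : ℝ} (h1 : Exc f q.1 b)
    (h2 : Exc f q.2 d) (s : ℝ) :
    (uf f q s = 0 ∧ (s ≤ q.1 ∨ d ≤ s)) ∨ (uf f q s = 1 ∧ q.1 < q.2 ∧ b ≤ s ∧ s ≤ q.2) ∨
    (f s ≠ hawaiianBasepoint ∧ hIdx (f s) = excIdx f q.1 ∧ 0 < uf f q s ∧ uf f q s < 1 ∧
      q.1 < s ∧ s < d ∧ uf f q s = (1 - sgn (startPos f q.1) * hTh (f s)) / 2) := by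
  obtain ⟨a, c⟩ := q
  simp only at *
  rcases hq with ⟨heq, -, hne⟩ | ⟨hlt, ha, hc, hi, hsg⟩
  · simp only at heq hne
    subst heq
    have hbd := h1.unique h2
    subst hbd
    have e : uf f (a, a) s = vf f a s := by simp [uf]
    rw [e]
    rcases le_or_gt s a with hs | hs
    · exact Or.inl ⟨vf_le hs, Or.inl hs⟩
    · rcases lt_or_ge s b with hs' | hs'
      · right; right
        have := vf_mid_bd h1 ⟨hs, hs'⟩
        exact ⟨h1.ne s ⟨hs, hs'⟩, h1.idx_eq hf ⟨hs, hs'⟩, this.1, this.2, hs, hs', vf_mid h1 ⟨hs, hs'⟩⟩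
      · left
        exact ⟨by rw [vf_ge h1 hs', vEnd_iness h1 hne], Or.inr hs'⟩
  · simp only at hlt ha hc hi hsg
    have e : uf f (a, c) s = vf f a s - vf f c s := by simp [uf, hlt.ne]
    rw [e]
    have hbc := h1.le_of_lt h2 hlt
    rcases le_or_gt s a with hs | hs
    · exact Or.inl ⟨by rw [vf_le hs, vf_le (hs.trans hlt.le), sub_zero], Or.inl hs⟩
    rcases lt_or_ge s b with hs' | hs'
    · right; right
      have := vf_mid_bd h1 ⟨hs, hs'⟩
      rw [vf_le (hs'.le.trans hbc), sub_zero]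
      exact ⟨h1.ne s ⟨hs, hs'⟩, h1.idx_eq hf ⟨hs, hs'⟩, this.1, this.2, hs,
        by linarith [h2.lt], vf_mid h1 ⟨hs, hs'⟩⟩
    rw [vf_ge h1 hs', vEnd_ess ha]
    rcases le_or_gt s c with hs2 | hs2
    · right; left
      exact ⟨by rw [vf_le hs2, sub_zero], hlt, hs', hs2⟩
    rcases lt_or_ge s d with hs3 | hs3
    · right; right
      have := vf_mid_bd h2 ⟨hs2, hs3⟩
      refine ⟨h2.ne s ⟨hs2, hs3⟩, by rw [h2.idx_eq hf ⟨hs2, hs3⟩, hi], by linarith, by linarith, hs,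
        hs3, ?_⟩
      rw [vf_mid h2 ⟨hs2, hs3⟩]
      rcases sgn_cases (startPos f a) with ⟨g1, g2⟩ | ⟨g1, g2⟩ <;>
      rcases sgn_cases (startPos f c) with ⟨g3, g4⟩ | ⟨g3, g4⟩
      · exact absurd ⟨fun _ => g3, fun _ => g1⟩ hsg
      · rw [g2, g4]; ring
      · rw [g2, g4]; ring
      · exact absurd ⟨fun h => absurd h g1, fun h => absurd h g3⟩ hsg
    · left
      exact ⟨by rw [vf_ge h2 hs3, vEnd_ess hc, sub_self], Or.inr hs3⟩

lemma Adm.exc {q : ℝ × ℝ} (hq : Adm f q) : ∃ b d, Exc f q.1 b ∧ Exc f q.2 d := by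
  rcases hq with ⟨heq, ⟨b, hb⟩, -⟩ | ⟨-, ha, hc, -⟩
  · exact ⟨b, b, hb, heq ▸ hb⟩
  · obtain ⟨b, hb⟩ := ha.1
    obtain ⟨d, hd⟩ := hc.1
    exact ⟨b, d, hb, hd⟩

lemma uf_bounds (hf : Continuous f) {q : ℝ × ℝ} (hq : Adm f q) (s : ℝ) : 0 ≤ uf f q s ∧ uf f q s ≤ 1 := by
  obtain ⟨b, d, h1, h2⟩ := hq.exc
  rcases uf_cases hf hq h1 h2 s with h | h | h
  · rw [h.1]; norm_num
  · rw [h.1]; norm_num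
  · exact ⟨h.2.2.1.le, h.2.2.2.1.le⟩

lemma uf_cont (hf : Continuous f) {q : ℝ × ℝ} (hq : Adm f q) : Continuous (uf f q) := by
  obtain ⟨b, d, h1, h2⟩ := hq.exc
  unfold uf
  split_ifs
  · exact vf_cont hf h1
  · exact (vf_cont hf h1).sub (vf_cont hf h2)

lemma uf_supp (hf : Continuous f) {q : ℝ × ℝ} (hq : Adm f q) {b d : ℝ} (h1 : Exc f q.1 b)
    (h2 : Exc f q.2 d) {s : ℝ} (hs : 0 < uf f q s) : q.1 < s ∧ s < d := by
  rcases uf_cases hf hq h1 h2 s with h | h | h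
  · rw [h.1] at hs; exact absurd hs (lt_irrefl _)
  · exact ⟨h1.lt.trans_le h.2.2.1, h.2.2.2.trans_lt h2.lt⟩
  · exact ⟨h.2.2.2.2.1, h.2.2.2.2.2.1⟩

lemma uf_zero (hf : Continuous f) {q : ℝ × ℝ} (hq : Adm f q) {b d : ℝ} (h1 : Exc f q.1 b)
    (h2 : Exc f q.2 d) {s : ℝ} (hs : s ≤ q.1 ∨ d ≤ s) : uf f q s = 0 := by
  have h0 := (uf_bounds hf hq s).1
  by_contra hc
  have := uf_supp hf hq h1 h2 (lt_of_le_of_ne h0 (Ne.symm hc))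
  rcases hs with h | h <;> linarith [this.1, this.2]

lemma uf_one {q : ℝ × ℝ} (hq : Adm f q) (hlt : q.1 < q.2) {b : ℝ} (h1 : Exc f q.1 b)
    {s : ℝ} (hs : b ≤ s) (hs' : s ≤ q.2) : uf f q s = 1 := by
  rcases hq with ⟨heq, -⟩ | ⟨-, ha, hc, hi, hsg⟩
  · exact absurd heq hlt.ne
  · rw [uf, if_neg hlt.ne, vf_le hs', vf_ge h1 hs, vEnd_ess ha, sub_zero]

/-- inner support lies where the outer function is one -/
lemma uf_nested (hf : Continuous f) {q q' : ℝ × ℝ} (hq : Adm f q) (hq' : Adm f q')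
    (h1 : q'.1 < q.1) (h2 : q.2 < q'.2) {s : ℝ} (hs : 0 < uf f q s) : uf f q' s = 1 := by
  obtain ⟨b, d, e1, e2⟩ := hq.exc
  obtain ⟨b', d', e1', e2'⟩ := hq'.exc
  have hle : q.1 ≤ q.2 := by
    rcases hq with h | h
    · exact h.1.le
    · exact h.1.le
  have := uf_supp hf hq e1 e2 hs
  exact uf_one hq' (h1.trans_le (hle.trans h2.le)) e1' ((e1'.le_of_lt e1 h1).trans this.1.le)
    (this.2.le.trans (e2.le_of_lt e2' h2))

lemma uf_disj (hf : Continuous f) {q q' : ℝ × ℝ} (hq : Adm f q) (hq' : Adm f q')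
    (h : q.2 < q'.1 ∨ q'.2 < q.1) {s : ℝ} (hs : 0 < uf f q s) : uf f q' s = 0 := by
  obtain ⟨b, d, e1, e2⟩ := hq.exc
  obtain ⟨b', d', e1', e2'⟩ := hq'.exc
  have := uf_supp hf hq e1 e2 hs
  apply uf_zero hf hq' e1' e2'
  rcases h with h | h
  · exact Or.inl (this.2.le.trans (e2.le_of_lt e1' h))
  · exact Or.inr ((e2'.le_of_lt e1 h).trans this.1.le)

theorem null_of_hPhi (γ : Path hawaiianBasepoint hawaiianBasepoint) (h : ∀ n, 1 ≤ n → hPhi n γ = 1) :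
    γ.Homotopic (Path.refl hawaiianBasepoint) := by
  obtain ⟨f, hfdef⟩ : ∃ f : ℝ → HE, ∀ s, f s = γ (projIcc 0 1 zero_le_one s) := ⟨_, fun _ => rfl⟩
  have hff : f = γ ∘ projIcc 0 1 zero_le_one := funext hfdef
  have hf : Continuous f := by rw [hff]; exact γ.continuous.comp continuous_projIcc
  have h0 : ∀ s ≤ 0, f s = hawaiianBasepoint := by
    intro s hs
    rw [hfdef, projIcc_of_le_left _ hs]; exact γ.source
  have h1 : ∀ s, 1 ≤ s → f s = hawaiianBasepoint := by
    intro s hs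
    rw [hfdef, projIcc_of_right_le _ hs]; exact γ.target
  have hfI : ∀ s : I, f s = γ s := by
    intro s
    rw [hfdef, projIcc_val]
  obtain ⟨M, m1, m2, m3⟩ := exists_limit_matching (letter f) {a | ess f a} (by
    intro n hn
    obtain ⟨g, hg, hg0⟩ := dev_path n γ
    have hG : HDev n f (g ∘ projIcc 0 1 zero_le_one) := by
      rw [hff]; exact hg.comp continuous_projIcc
    have e0 : projIcc (0 : ℝ) 1 zero_le_one 0 = 0 := projIcc_left _
    have e1 : projIcc (0 : ℝ) 1 zero_le_one 1 = 1 := projIcc_right _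
    obtain ⟨L, l1, l2, l3⟩ := exc_word hf h0 h1 hG (by simp only [Function.comp, e0, hg0]) 1 zero_le_one
      (h1 1 le_rfl)
    refine ⟨L, l1, fun x => ?_, ?_⟩
    · rw [l2]
      constructor
      · rintro ⟨⟨a1, a2⟩, -⟩; exact ⟨a1, a2⟩
      · rintro ⟨a1, a2⟩
        obtain ⟨b, hb⟩ := a1.1
        exact ⟨⟨a1, a2⟩, hb.lt.trans_le (hb.le_one h1)⟩
    · rw [← l3]
      simp only [Function.comp, e1]
      rw [← hPhi_eq hg hg0, h n hn])
  have adm_of_M : ∀ p ∈ M, Adm f p := by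
    intro p hp
    obtain ⟨a1, a2, a3, a4, a5⟩ := m1 p hp
    refine Or.inr ⟨a3, a1, a2, a4, fun hc => a5 ?_⟩
    simp only [letter]
    exact decide_eq_decide.2 hc
  let Qs : Set (ℝ × ℝ) := {q | (q.1 = q.2 ∧ (∃ b, Exc f q.1 b) ∧ ¬ ess f q.1) ∨ q ∈ M}
  have hQ : ∀ q ∈ Qs, Adm f q := by
    rintro q (hq | hq)
    · exact Or.inl hq
    · exact adm_of_M q hq
  have hcount : Qs.Countable := by
    have hL : {a | ∃ b, Exc f a b}.Countable := by
      refine PairwiseDisjoint.countable_of_Ioo (y := rb f) ?_ ?_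
      · rintro a ⟨b, hb⟩ a' ⟨b', hb'⟩ hne
        simp only [Function.onFun, hb.rb_eq, hb'.rb_eq]
        rw [Set.disjoint_left]
        intro s hs hs'
        rcases lt_or_gt_of_ne hne with hlt | hlt
        · have := hb.le_of_lt hb' hlt
          linarith [hs.2, hs'.1]
        · have := hb'.le_of_lt hb hlt
          linarith [hs.1, hs'.2]
      · rintro a ⟨b, hb⟩
        rw [hb.rb_eq]; exact hb.lt
    refine (hL.prod hL).mono ?_
    intro q hq
    obtain ⟨b, d, e1, e2⟩ := (hQ q hq).exc
    exact ⟨⟨b, e1⟩, ⟨d, e2⟩⟩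
  have hlam : ∀ q ∈ Qs, ∀ q' ∈ Qs, q ≠ q' → HLam q q' := by
    have mixed : ∀ q q' : ℝ × ℝ, (q.1 = q.2 ∧ (∃ b, Exc f q.1 b) ∧ ¬ ess f q.1) → q' ∈ M →
        q.2 < q'.1 ∨ q'.2 < q.1 ∨ (q'.1 < q.1 ∧ q.2 < q'.2) := by
      rintro q q' ⟨b1, -, b2⟩ hq'
      obtain ⟨a1, a2, a3, -⟩ := m1 q' hq'
      have n1 : q.1 ≠ q'.1 := fun e => b2 (e ▸ a1)
      have n2 : q.1 ≠ q'.2 := fun e => b2 (e ▸ a2)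
      rcases lt_or_gt_of_ne n1 with h | h
      · left; rw [← b1]; exact h
      · rcases lt_or_gt_of_ne n2 with h' | h'
        · right; right; exact ⟨h, by rw [← b1]; exact h'⟩
        · right; left; exact h'
    rintro q (hq | hq) q' (hq' | hq') hne
    · have : q.1 ≠ q'.1 := fun e => hne (Prod.ext e (by rw [← hq.1, ← hq'.1, e]))
      rcases lt_or_gt_of_ne this with h | h
      · left; rw [← hq.1]; exact h
      · right; left; rw [← hq'.1]; exact h
    · have := mixed q q' hq hq'
      unfold HLam
      tauto
    · have := mixed q' q hq' hq
      unfold HLam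
      tauto
    · exact m3 q hq q' hq' hne
  have : Countable Qs := hcount.to_subtype
  refine null_of_laminar γ (Q := Qs) (fun q s => uf f q.1 (s : ℝ))
    (fun q => (uf_cont hf (hQ q.1 q.2)).comp continuous_subtype_val)
    (fun q s => (uf_bounds hf (hQ q.1 q.2) s).1) (fun q s => (uf_bounds hf (hQ q.1 q.2) s).2)
    ?_ ?_ ?_ ?_ ?_
  · intro q
    obtain ⟨b, d, e1, e2⟩ := (hQ q.1 q.2).exc
    exact uf_zero hf (hQ q.1 q.2) e1 e2 (Or.inl (e1.nonneg h0))
  · intro q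
    obtain ⟨b, d, e1, e2⟩ := (hQ q.1 q.2).exc
    exact uf_zero hf (hQ q.1 q.2) e1 e2 (Or.inr (e2.le_one h1))
  · intro q q' hne
    have A := hQ q.1 q.2
    have A' := hQ q'.1 q'.2
    rcases hlam q.1 q.2 q'.1 q'.2 (fun e => hne (Subtype.ext e)) with h | h | h | h
    · exact Or.inr (Or.inr fun s hs => uf_disj hf A A' (Or.inl h) hs)
    · exact Or.inr (Or.inr fun s hs => uf_disj hf A A' (Or.inr h) hs)
    · first
      | exact Or.inl fun s hs => uf_nested hf A' A h.1 h.2 hs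
      | exact Or.inr (Or.inl fun s hs => uf_nested hf A A' h.1 h.2 hs)
    · first
      | exact Or.inl fun s hs => uf_nested hf A' A h.1 h.2 hs
      | exact Or.inr (Or.inl fun s hs => uf_nested hf A A' h.1 h.2 hs)
  · intro q s t hs0 hs1 hst
    have A := hQ q.1 q.2
    obtain ⟨b, d, e1, e2⟩ := A.exc
    have key : ∀ s : ℝ, 0 < uf f q.1 s → uf f q.1 s < 1 → f s ≠ hawaiianBasepoint ∧
        hIdx (f s) = excIdx f q.1.1 ∧ uf f q.1 s = (1 - sgn (startPos f q.1.1) * hTh (f s)) / 2 := by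
      intro s hs0 hs1
      rcases uf_cases hf A e1 e2 s with h | h | h
      · rw [h.1] at hs0; exact absurd hs0 (lt_irrefl _)
      · rw [h.1] at hs1; exact absurd hs1 (lt_irrefl _)
      · exact ⟨h.1, h.2.1, h.2.2.2.2.2.2⟩
    obtain ⟨a1, a2, a3⟩ := key s hs0 hs1
    obtain ⟨b1, b2, b3⟩ := key t (hst ▸ hs0) (hst ▸ hs1)
    rw [← hfI, ← hfI]
    apply he_eq_of a1 b1 (a2.trans b2.symm)
    have : sgn (startPos f q.1.1) * hTh (f s) = sgn (startPos f q.1.1) * hTh (f t) := by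
      have hst' : uf f q.1 s = uf f q.1 t := hst
      linarith
    rcases sgn_cases (startPos f q.1.1) with ⟨_, h2⟩ | ⟨_, h2⟩ <;> rw [h2] at this <;> linarith
  · intro s hs
    rw [← hfI] at hs
    obtain ⟨a, b, hE, hab⟩ := exc_exists hf h0 h1 hs
    by_cases he : ess f a
    · obtain ⟨p, hp, hpa⟩ := m2 a he
      refine ⟨⟨p, Or.inr hp⟩, ?_⟩
      obtain ⟨c1, c2, c3, -⟩ := m1 p hp
      have hu : uf f p s = vf f p.1 s - vf f p.2 s := by simp [uf, c3.ne]
      have hbd := vf_mid_bd hE hab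
      change 0 < uf f p s ∧ uf f p s < 1
      rw [hu]
      rcases hpa with e | e
      · obtain ⟨d, hd⟩ := c2.1
        have := hE.le_of_lt hd (e ▸ c3)
        rw [e, vf_le (hab.2.le.trans this), sub_zero]
        exact hbd
      · obtain ⟨d, hd⟩ := c1.1
        have := hd.le_of_lt hE (e ▸ c3)
        rw [e, vf_ge hd (this.trans hab.1.le), vEnd_ess c1]
        constructor <;> linarith [hbd.1, hbd.2]
    · refine ⟨⟨(a, a), Or.inl ⟨rfl, ⟨b, hE⟩, he⟩⟩, ?_⟩
      have hu : uf f (a, a) s = vf f a s := by simp [uf]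
      change 0 < uf f (a, a) s ∧ uf f (a, a) s < 1
      rw [hu]
      exact vf_mid_bd hE hab

end HawaiianFinal

/-- There is an open subgroup `K` of `π₁(𝓗, 0)` (open meaning: the preimage of `K`
under the map `h : Ω(𝓗,0) → π₁(𝓗,0)`, where `Ω(𝓗,0)` carries the compact-open
topology, is open) which is core-free: the only normal subgroup of `π₁(𝓗,0)`
contained in `K` is the trivial one. -/
theorem exists_corefree_open_subgroup_of_hawaiianEarring :
    ∃ K : Subgroup (FundamentalGroup HawaiianEarring hawaiianBasepoint),
      IsOpen {γ : Path hawaiianBasepoint hawaiianBasepoint | pathClass γ ∈ K} ∧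
      ∀ N : Subgroup (FundamentalGroup HawaiianEarring hawaiianBasepoint),
        N.Normal → N ≤ K → N = ⊥ := by
  refine ⟨hK, hK_open, fun N hN hle => ?_⟩
  rw [Subgroup.eq_bot_iff_forall]
  intro x hx
  obtain ⟨γ, rfl⟩ := pathClass_surj x
  have h := null_of_hPhi γ (fun n hn => core_trivial N hN hle γ hx n hn)
  exact Quotient.sound h
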